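/- Let p be a prime, n ≥ 1 an integer, and ε ∈ ℤ. Let f : ℚ_p → ℚ_p be a definable function and set D = {x ∈ ℚ_p : x ≠ 0, v(x) ≥ ε, x ∈ P_n}. Then there exist an integer δ ≥ ε and a positive multiple m of n such that, with S = {x ∈ ℚ_p : x ≠ 0, v(x) ≥ δ, x ∈ P_m}, one of the following holds: (1) f x = 0 for all x ∈ S; or (2) there exist C ∈ ℚ_pˣ, integers a ∈ ℤ and b ≥ 1, and a group homomorphism h : P_m → ℚ_pˣ with (h x)^b = x^a for all x ∈ P_m, such that f x / (C · h x) tends to 1 as x → 0 within S. -/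

import Mathlib

open FirstOrder Filter Topology

/-- The ring-language structure on `ℚ_[p]`. -/
noncomputable instance (p : ℕ) [Fact p.Prime] : FirstOrder.Language.ring.Structure ℚ_[p] :=
  (FirstOrder.Ring.compatibleRingOfRing ℚ_[p]).toStructure

section

open Polynomial

/-- `x` is an `n`-th power (possibly zero). -/
def IsNthPow {K : Type*} [Monoid K] (n : ℕ) (x : K) : Prop := ∃ y, y ^ n = x

/-- A field with an absolute value satisfying the first-order properties of `ℚ_[p]` that are needed
for quantifier elimination. -/
structure PadicLike (p : ℕ) {K R : Type*} [Field K] [Field R] [LinearOrder R]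
    [IsStrictOrderedRing R] (N : AbsoluteValue K R) : Prop where
  add_le_max : ∀ x y, N (x + y) ≤ max (N x) (N y)
  p_pos : 0 < N p
  p_lt_one : N p < 1
  natCast_ge : ∀ k : ℕ, k ≠ 0 → ∃ M : ℕ, N p ^ M ≤ N k
  residue : ∀ (M : ℕ) (u : K), N u ≤ 1 → ∃ k : ℕ, N (u - k) ≤ N p ^ M
  discrete : ∀ z, N z < 1 → N z ≤ N p
  rep : ∀ n : ℕ, 0 < n → ∀ z : K, z ≠ 0 → ∃ q : ℕ, q ≠ 0 ∧ ∃ w, z = q * w ^ n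
  isNthPow_of_near : ∀ n : ℕ, 0 < n → ∃ M : ℕ, ∀ u, N (u - 1) ≤ N p ^ M → IsNthPow n u
  le_one_iff : ∀ z, N z ≤ 1 ↔ IsNthPow 2 (1 + (p : K) ^ 3 * z ^ 4)
  hensel : ∀ (d : ℕ) (b : ℕ → K), N (b 0) ≤ 1 → (∀ i, 2 ≤ i → N (b i) < 1) →
    ∃ z, N z ≤ 1 ∧ b 0 + z + ∑ i ∈ Finset.Ico 2 d, b i * z ^ i = 0

namespace PadicLike

section Basic

variable {p : ℕ} {K R : Type*} [Field K] [Field R] [LinearOrder R] [IsStrictOrderedRing R]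
  {N : AbsoluteValue K R}

section
variable (hN : PadicLike p N)
include hN

theorem sum_le {ι : Type*} (s : Finset ι) (f : ι → K) {B : R} (hB : 0 ≤ B)
    (h : ∀ i ∈ s, N (f i) ≤ B) : N (∑ i ∈ s, f i) ≤ B := by
  classical
  induction s using Finset.induction_on with
  | empty => simpa using hB
  | insert a s ha ih =>
    rw [Finset.sum_insert ha]
    refine (hN.add_le_max _ _).trans (max_le (h a (by simp)) (ih fun i hi => h i (by simp [hi])))

theorem sum_lt {ι : Type*} (s : Finset ι) (f : ι → K) {B : R} (hB : 0 < B)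
    (h : ∀ i ∈ s, N (f i) < B) : N (∑ i ∈ s, f i) < B := by
  classical
  induction s using Finset.induction_on with
  | empty => simpa using hB
  | insert a s ha ih =>
    rw [Finset.sum_insert ha]
    exact (hN.add_le_max _ _).trans_lt
      (max_lt (h a (by simp)) (ih fun i hi => h i (by simp [hi])))

theorem sub_le_max (x y : K) : N (x - y) ≤ max (N x) (N y) := by
  have := hN.add_le_max x (-y)
  rwa [← sub_eq_add_neg, N.map_neg] at this

theorem eq_of_sub_lt {x y : K} (h : N (x - y) < N y) : N x = N y := by
  apply le_antisymm
  · have := hN.add_le_max (x - y) y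
    rw [sub_add_cancel, max_eq_right h.le] at this
    exact this
  · by_contra hlt
    push Not at hlt
    have := hN.sub_le_max x (x - y)
    rw [sub_sub_cancel] at this
    exact absurd this (not_le.2 (max_lt hlt h))

theorem natCast_ne_zero {k : ℕ} (hk : k ≠ 0) : (k : K) ≠ 0 := by
  obtain ⟨M, hM⟩ := hN.natCast_ge k hk
  have := (pow_pos hN.p_pos M).trans_le hM
  exact N.pos_iff.1 this

theorem charZero : CharZero K :=
  charZero_of_inj_zero fun n hn => by
    by_contra h
    exact hN.natCast_ne_zero h hn

theorem p_ne_zero : (p : K) ≠ 0 := N.pos_iff.1 hN.p_pos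

theorem pow_pos (M : ℕ) : 0 < N p ^ M := _root_.pow_pos hN.p_pos M

theorem pow_le_one (M : ℕ) : N p ^ M ≤ 1 := pow_le_one₀ hN.p_pos.le hN.p_lt_one.le

theorem pow_le_pow {M M' : ℕ} (h : M ≤ M') : N p ^ M' ≤ N p ^ M :=
  pow_le_pow_of_le_one hN.p_pos.le hN.p_lt_one.le h

theorem natCast_le_one (k : ℕ) : N k ≤ 1 := by
  induction k with
  | zero => simp
  | succ k ih =>
    push_cast
    exact (hN.add_le_max _ _).trans (max_le ih (by simp))

theorem le_of_lt {a b : K} (h : N a < N b) : N a ≤ N p * N b := by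
  have hb : 0 < N b := (N.nonneg a).trans_lt h
  have : N (a / b) ≤ N p := hN.discrete _ (by rw [map_div₀, div_lt_one hb]; exact h)
  rwa [map_div₀, div_le_iff₀ hb] at this

/-- Elements that are close to each other are simultaneously `n`-th powers. -/
theorem exists_isNthPow_congr (n : ℕ) (hn : 0 < n) : ∃ M : ℕ, ∀ M' ≥ M, ∀ a b,
    N (a - b) ≤ N p ^ M' * N b → (IsNthPow n a ↔ IsNthPow n b) := by
  obtain ⟨M, hM⟩ := hN.isNthPow_of_near n hn
  refine ⟨M + 1, fun M' hM' a b hab => ?_⟩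
  by_cases hb : b = 0
  · subst hb
    rw [map_zero, mul_zero, sub_zero] at hab
    rw [N.eq_zero.1 (hab.antisymm (N.nonneg _))]
  have hb' := N.pos hb
  obtain ⟨y, hy⟩ := hM (a / b) (by
    rw [show a / b - 1 = (a - b) / b by field_simp, map_div₀, div_le_iff₀ hb']
    exact hab.trans (mul_le_mul_of_nonneg_right (hN.pow_le_pow (by omega)) hb'.le))
  have ha : a ≠ 0 := by
    rintro rfl
    rw [zero_sub, N.map_neg] at hab
    have : N p ^ M' < 1 := pow_lt_one₀ hN.p_pos.le hN.p_lt_one (by omega)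
    nlinarith
  have hy0 : y ≠ 0 := by
    rintro rfl
    rw [zero_pow hn.ne', eq_comm, div_eq_zero_iff] at hy
    tauto
  have hab' : a = y ^ n * b := by rw [hy]; field_simp
  constructor
  · rintro ⟨z, rfl⟩
    exact ⟨z / y, by rw [div_pow, hab']; field_simp⟩
  · rintro ⟨z, rfl⟩
    exact ⟨y * z, by rw [hab']; ring⟩

/-- Distances that are not attained by the subfield `A` are infinitely far from those that are. -/
theorem lt_of_lt_of_notMem {A : Subfield K} {a b : K} (ha : a ∈ A)
    (hb : ∀ x ∈ A, N b ≠ N x) : (N b < N a → ∀ M : ℕ, N b < N p ^ M * N a) ∧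
      (N a < N b → ∀ M : ℕ, N a < N p ^ M * N b) := by
  have hp : ∀ M : ℕ, (p : K) ^ M ∈ A := fun M => pow_mem (natCast_mem A p) M
  have hpp := hN.p_pos
  constructor
  · intro h M
    induction M with
    | zero => simpa using h
    | succ M ih =>
      rw [← map_pow, ← map_mul] at ih
      have := hN.le_of_lt ih
      refine lt_of_le_of_ne (this.trans (le_of_eq ?_)) ?_
      · rw [map_mul, map_pow, pow_succ]; ring
      · rw [← map_pow, ← map_mul]; exact hb _ (mul_mem (hp _) ha)
  · intro h M
    induction M with
    | zero => simpa using h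
    | succ M ih =>
      rw [← map_pow, ← map_mul] at ih
      have := hN.le_of_lt ih
      refine lt_of_le_of_ne (this.trans (le_of_eq ?_)) ?_
      · rw [map_mul, map_pow, pow_succ]; ring
      · intro h'
        apply hb _ (div_mem ha (hp (M + 1)))
        rw [map_div₀, h', map_pow]
        field_simp

/-- If a power of `x` has the same size as an element of `A`, then some element of the same size
as `x` has that power in `A`. -/
theorem exists_pow_mem {A : Subfield K} {x a : K} (ha : a ∈ A) (ha0 : a ≠ 0) {e : ℕ} (he : 0 < e)
    (h : N x ^ e = N a) : ∃ y, N y = N x ∧ y ^ e ∈ A := by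
  obtain ⟨M, hM⟩ := hN.exists_isNthPow_congr e he
  have hx : x ≠ 0 := by
    rintro rfl
    rw [map_zero, zero_pow he.ne'] at h
    exact (N.pos ha0).ne h
  have hu : N (x ^ e / a) = 1 := by
    rw [map_div₀, map_pow, h, div_self (N.pos ha0).ne']
  obtain ⟨k, hk⟩ := hN.residue (M + 1) _ hu.le
  obtain ⟨y, hy⟩ := (hM (M + 1) (by omega) (k * a) (x ^ e) (by
    rw [show (k : K) * a - x ^ e = -((x ^ e / a - k) * a) by field_simp; ring, N.map_neg, map_mul,
      map_pow, h]
    exact mul_le_mul_of_nonneg_right hk (N.nonneg _))).2 ⟨x, rfl⟩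
  refine ⟨y, ?_, hy ▸ mul_mem (natCast_mem A k) ha⟩
  have hk1 : N k = 1 := by
    rw [← hu]
    refine (hN.eq_of_sub_lt ?_)
    rw [hu, ← N.map_neg, neg_sub]
    exact hk.trans_lt (pow_lt_one₀ hN.p_pos.le hN.p_lt_one (by omega))
  rw [← pow_left_inj₀ (N.nonneg _) (N.nonneg _) he.ne', h, ← map_pow, hy, map_mul, hk1, one_mul]

end

/-- The polynomial `f` is dominated on the ball with center `c` and radius `ρ` by its value at `c`,
up to a factor `N p ^ M`. -/
def Dom (N : AbsoluteValue K R) (p M : ℕ) (f : K[X]) (c : K) (ρ : R) : Prop :=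
  ∀ i, 1 ≤ i → N ((taylor c f).coeff i) * ρ ^ i ≤ N p ^ M * N (f.eval c)

theorem eval_add_eq_sum (f : K[X]) (c z : K) {D : ℕ} (hD : f.natDegree < D) :
    f.eval (c + z) = ∑ i ∈ Finset.range D, (taylor c f).coeff i * z ^ i := by
  rw [add_comm, ← taylor_eval, eval_eq_sum_range' (by rwa [natDegree_taylor])]

section
variable (hN : PadicLike p N)
include hN

theorem taylor_coeff_le (g : K[X]) (r : K) {ρ B : R} (hB : 0 ≤ B) (hr : N r ≤ ρ) (i : ℕ)
    (h : ∀ j, i ≤ j → N (g.coeff j) * ρ ^ j ≤ B) : N ((taylor r g).coeff i) * ρ ^ i ≤ B := by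
  have hρ : 0 ≤ ρ := (N.nonneg r).trans hr
  rcases hρ.eq_or_lt with h0 | h0
  · rcases Nat.eq_zero_or_pos i with rfl | hi
    · have : r = 0 := N.eq_zero.1 (le_antisymm (hr.trans h0.symm.le) (N.nonneg r))
      subst this
      simpa using h 0 le_rfl
    · rw [← h0, zero_pow hi.ne', mul_zero]; exact hB
  rw [taylor_coeff, hasseDeriv_apply, Polynomial.sum, eval_finsetSum, ← le_div_iff₀ (by positivity)]
  refine hN.sum_le _ _ (by positivity) fun j _ => ?_
  rw [eval_monomial]
  rcases lt_or_ge j i with hji | hji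
  · rw [Nat.choose_eq_zero_of_lt hji]; simp; positivity
  rw [le_div_iff₀ (by positivity), map_mul, map_mul, map_pow]
  refine le_trans ?_ (h j hji)
  have h1 := hN.natCast_le_one (j.choose i)
  have h2 : N r ^ (j - i) ≤ ρ ^ (j - i) := pow_le_pow_left₀ (N.nonneg _) hr _
  calc N (j.choose i) * N (g.coeff j) * N r ^ (j - i) * ρ ^ i
      ≤ 1 * N (g.coeff j) * ρ ^ (j - i) * ρ ^ i := by
        have := N.nonneg (g.coeff j)
        gcongr
    _ = N (g.coeff j) * ρ ^ j := by
        rw [one_mul, mul_assoc, ← pow_add, Nat.sub_add_cancel hji]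

theorem eval_sub_le {M : ℕ} {f : K[X]} {c : K} {ρ : R} (h : Dom N p M f c ρ) {z : K}
    (hz : N z ≤ ρ) : N (f.eval (c + z) - f.eval c) ≤ N p ^ M * N (f.eval c) := by
  rw [eval_add_eq_sum f c z (Nat.lt_succ_self _), Finset.sum_range_succ', pow_zero, mul_one,
    taylor_coeff_zero, add_sub_cancel_right]
  refine hN.sum_le _ _ (mul_nonneg (hN.pow_pos M).le (N.nonneg _)) fun i _ => ?_
  refine le_trans ?_ (h (i + 1) (by omega))
  rw [map_mul, map_pow]
  exact mul_le_mul_of_nonneg_left (pow_le_pow_left₀ (N.nonneg _) hz _) (N.nonneg _)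

theorem Dom.recenter {M : ℕ} (hM : 1 ≤ M) {f : K[X]} {c c' : K} {ρ : R} (h : Dom N p M f c ρ)
    (hc : N (c' - c) ≤ ρ) : Dom N p M f c' ρ ∧ N (f.eval c') = N (f.eval c) := by
  have h1 := hN.eval_sub_le h hc
  rw [add_sub_cancel] at h1
  have h2 : N (f.eval c') = N (f.eval c) := by
    by_cases h0 : f.eval c = 0
    · rw [h0, map_zero, mul_zero, sub_zero] at h1
      rw [h0, map_zero]
      exact h1.antisymm (N.nonneg _)
    · apply hN.eq_of_sub_lt
      have := N.pos h0
      have h3 : N p ^ M < 1 := pow_lt_one₀ hN.p_pos.le hN.p_lt_one (by omega)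
      nlinarith
  refine ⟨fun i hi => ?_, h2⟩
  rw [h2, show c' = (c' - c) + c by ring, ← taylor_taylor]
  exact hN.taylor_coeff_le _ _ (mul_nonneg (hN.pow_pos M).le (N.nonneg _)) hc i
    fun j hj => h j (hi.trans hj)

/-- Newton's lemma. -/
theorem newton (f : K[X]) (a s : K) (h0 : N (f.eval a) ≤ N (f.derivative.eval a) * N s)
    (h : ∀ i, 2 ≤ i →
      N ((taylor a f).coeff i) * N s ^ i < N (f.derivative.eval a) * N s) :
    ∃ z, f.IsRoot z ∧ N (z - a) ≤ N s ∧ N (z - a) * N (f.derivative.eval a) = N (f.eval a) := by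
  set q := f.derivative.eval a with hq
  have hqs : 0 < N q * N s := by
    refine lt_of_le_of_lt ?_ (h 2 le_rfl)
    have := N.nonneg ((taylor a f).coeff 2)
    have := N.nonneg s
    positivity
  have hs : s ≠ 0 := by rintro rfl; simp at hqs
  have hq0 : q ≠ 0 := by rintro h; rw [h] at hqs; simp at hqs
  set b : ℕ → K := fun i => (taylor a f).coeff i * s ^ i / (q * s) with hb
  have hb0 : N (b 0) ≤ 1 := by
    simp only [hb, map_div₀, map_mul, taylor_coeff_zero, pow_zero, mul_one]
    rwa [div_le_one hqs]
  have hb2 : ∀ i, 2 ≤ i → N (b i) < 1 := fun i hi => by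
    simp only [hb, map_div₀, map_mul, map_pow]
    rw [div_lt_one hqs]
    exact h i hi
  obtain ⟨z, hz1, hz⟩ := hN.hensel (f.natDegree + 2) b hb0 hb2
  have hNz : N z = N (b 0) := by
    by_cases hz0 : z = 0
    · subst hz0
      rw [Finset.sum_eq_zero (fun i hi => by
        rw [zero_pow (by simp at hi; omega), mul_zero]), add_zero, add_zero] at hz
      rw [hz]
    · have hzpos := N.pos hz0
      rw [show b 0 = -(z + ∑ i ∈ Finset.Ico 2 (f.natDegree + 2), b i * z ^ i) by
        linear_combination hz, N.map_neg]
      symm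
      apply hN.eq_of_sub_lt
      rw [add_sub_cancel_left]
      refine hN.sum_lt _ _ hzpos fun i hi => ?_
      have hi2 : 2 ≤ i := by simp at hi; omega
      rw [map_mul, map_pow]
      calc N (b i) * N z ^ i < 1 * N z ^ i := by
            have := hb2 i hi2
            gcongr
        _ ≤ N z := by
            rw [one_mul]
            exact pow_le_of_le_one (N.nonneg _) hz1 (by omega)
  refine ⟨a + s * z, ?_, ?_, ?_⟩
  · rw [IsRoot.def, eval_add_eq_sum f a (s * z) (show f.natDegree < f.natDegree + 2 by omega),
      Finset.range_eq_Ico, Finset.sum_eq_sum_Ico_succ_bot (by omega),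
      Finset.sum_eq_sum_Ico_succ_bot (by omega)]
    have : ∀ i, (taylor a f).coeff i * (s * z) ^ i = q * s * (b i * z ^ i) := fun i => by
      simp only [hb]; rw [mul_pow]; field_simp
    simp only [this, ← Finset.mul_sum]
    rw [← add_assoc, ← mul_add, ← mul_add]
    have hb1 : b 1 = 1 := by
      simp only [hb, taylor_coeff_one, pow_one, ← hq]; field_simp
    norm_num [hb1] at hz ⊢
    right
    exact hz
  · rw [add_sub_cancel_left, map_mul]
    exact mul_le_of_le_one_right (N.nonneg _) hz1
  · rw [add_sub_cancel_left, map_mul, hNz]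
    simp only [hb, map_div₀, map_mul, taylor_coeff_zero, pow_zero, mul_one]
    have := N.pos hs
    have := N.pos hq0
    field_simp

end

end Basic

end PadicLike

namespace PadicLike

section OneSided

variable {p : ℕ} {K R : Type*} [Field K] [Field R] [LinearOrder R] [IsStrictOrderedRing R]
  {N : AbsoluteValue K R}

/-- The subfield `A` contains all the roots of polynomials over `A` of degree at most `d`. -/
def RootClosed (A : Subfield K) (d : ℕ) : Prop :=
  ∀ f : K[X], f ≠ 0 → f.natDegree ≤ d → (∀ i, f.coeff i ∈ A) → ∀ x, f.IsRoot x → x ∈ A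

/-- There is no best approximation of `α` by elements of `A`. -/
def NoBest (N : AbsoluteValue K R) (A : Subfield K) (α : K) : Prop :=
  ∀ c ∈ A, ∃ c' ∈ A, N (α - c') < N (α - c)

theorem exists_map_eq {A : Subfield K} {f : K[X]} (hf : ∀ i, f.coeff i ∈ A) :
    ∃ g : A[X], g.map A.subtype = f := by
  have : f ∈ lifts A.subtype := by
    rw [lifts_iff_coeff_lifts]
    exact fun i => ⟨⟨_, hf i⟩, rfl⟩
  rwa [mem_lifts] at this

theorem taylor_coeff_mem {A : Subfield K} {f : K[X]} (hf : ∀ i, f.coeff i ∈ A) {c : K}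
    (hc : c ∈ A) (i : ℕ) : (taylor c f).coeff i ∈ A := by
  obtain ⟨g, rfl⟩ := exists_map_eq hf
  have : taylor c (g.map A.subtype) = (taylor (⟨c, hc⟩ : A) g).map A.subtype := by
    rw [map_taylor]; rfl
  rw [this, coeff_map]
  exact Subtype.property _

section
variable (hN : PadicLike p N)
include hN

theorem NoBest.shrink {A : Subfield K} {α : K} (h : NoBest N A α) (M : ℕ) {c : K} (hc : c ∈ A) :
    ∃ c' ∈ A, N (α - c') ≤ N p ^ M * N (α - c) := by
  induction M with
  | zero => exact ⟨c, hc, by simp⟩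
  | succ M ih =>
    obtain ⟨c₁, hc₁, h₁⟩ := ih
    obtain ⟨c₂, hc₂, h₂⟩ := h c₁ hc₁
    refine ⟨c₂, hc₂, (hN.le_of_lt h₂).trans ?_⟩
    rw [pow_succ', mul_assoc]
    exact mul_le_mul_of_nonneg_left h₁ hN.p_pos.le

theorem exists_dom_lt {A : Subfield K} {d : ℕ} (hA : RootClosed A d) {α : K} (hα : NoBest N A α)
    (e : ℕ) : ∀ f : K[X], f ≠ 0 → f.natDegree = e → e ≤ d → (∀ i, f.coeff i ∈ A) →
      ∃ c ∈ A, ∀ i, 1 ≤ i → N ((taylor α f).coeff i) * N (α - c) ^ i < N (f.eval α) := by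
  have := hN.charZero
  induction e with
  | zero =>
    intro f hf he _ _
    refine ⟨0, zero_mem A, fun i hi => ?_⟩
    rw [coeff_eq_zero_of_natDegree_lt (by rw [natDegree_taylor]; omega), map_zero, zero_mul]
    rw [eq_C_of_natDegree_eq_zero he] at hf ⊢
    rw [eval_C]
    exact N.pos fun h => hf (by rw [h, C_0])
  | succ e ih =>
    intro f hf he hed hfA
    have hdeg : f.derivative.natDegree = e := by
      rw [natDegree_derivative, he, Nat.add_sub_cancel]
    have hf' : f.derivative ≠ 0 := by
      intro h
      have := derivative_eq_zero.1 h
      omega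
    obtain ⟨c₀, hc₀, h₀⟩ := ih f.derivative hf' hdeg (by omega) (fun i => by
      rw [coeff_derivative]
      exact mul_mem (hfA _) (by exact_mod_cast natCast_mem A (i + 1)))
    set q := f.derivative.eval α with hq
    -- a common lower bound for the sizes of the integers `2, ..., e + 1`
    obtain ⟨M, hM⟩ : ∃ M : ℕ, ∀ i ≤ e + 1, i ≠ 0 → N p ^ M ≤ N (i : K) := by
      choose! M hM using hN.natCast_ge
      refine ⟨(Finset.range (e + 2)).sup M, fun i hi hi0 => (hN.pow_le_pow ?_).trans (hM i hi0)⟩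
      exact Finset.le_sup (f := M) (Finset.mem_range.2 (by omega))
    obtain ⟨c₁, hc₁, h₁⟩ := NoBest.shrink hN hα (M + 1) hc₀
    have hαpos : ∀ c ∈ A, 0 < N (α - c) := fun c hc => by
      obtain ⟨c', -, h'⟩ := hα c hc
      exact (N.nonneg _).trans_lt h'
    have hqpos : 0 < N q := lt_of_le_of_lt
      (mul_nonneg (N.nonneg _) (pow_nonneg (N.nonneg _) _)) (h₀ 1 le_rfl)
    have key : ∀ c ∈ A, N (α - c) ≤ N (α - c₁) → ∀ i, 2 ≤ i →
        N ((taylor α f).coeff i) * N (α - c) ^ i < N q * N (α - c) := by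
      intro c hc hcc i hi
      rcases lt_or_ge (e + 1) i with hie | hie
      · rw [coeff_eq_zero_of_natDegree_lt (by rw [natDegree_taylor]; omega), map_zero, zero_mul]
        exact mul_pos hqpos (hαpos c hc)
      obtain ⟨j, rfl⟩ : ∃ j, i = j + 1 := ⟨i - 1, by omega⟩
      have h2 := h₀ j (by omega)
      have h3 : (taylor α f.derivative).coeff j = (taylor α f).coeff (j + 1) * ((j + 1 : ℕ) : K) := by
        rw [taylor_coeff, taylor_coeff, mul_comm]
        have := congrArg (eval α) (hasseDeriv_comp (R := K) j 1 |> fun h => LinearMap.congr_fun h f)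
        simp only [LinearMap.comp_apply, hasseDeriv_one, LinearMap.smul_apply, eval_smul] at this
        rw [this, Nat.choose_symm_add, Nat.choose_one_right, nsmul_eq_mul]
      rw [h3, map_mul] at h2
      have h4 : N (α - c) ≤ N p ^ (M + 1) * N (α - c₀) := hcc.trans h₁
      have h5 := hM (j + 1) hie (by omega)
      have hpM := hN.pow_pos M
      have hp1 := hN.pow_le_one (M + 1)
      have hn0 := N.nonneg ((taylor α f).coeff (j + 1))
      have hc0 := hαpos _ hc₀
      have h6 : N (α - c) ^ j ≤ N p ^ M * N (α - c₀) ^ j := by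
        calc N (α - c) ^ j ≤ (N p ^ (M + 1) * N (α - c₀)) ^ j := 
              pow_le_pow_left₀ (N.nonneg _) h4 _
          _ = (N p ^ (M + 1)) ^ j * N (α - c₀) ^ j := mul_pow _ _ _
          _ ≤ N p ^ M * N (α - c₀) ^ j := by
              refine mul_le_mul_of_nonneg_right ?_ (by positivity)
              exact (pow_le_of_le_one (hN.pow_pos _).le hp1 (by omega)).trans
                (hN.pow_le_pow (by omega))
      rw [pow_succ, ← mul_assoc]
      refine mul_lt_mul_of_pos_right (lt_of_le_of_lt ?_ h2) (hαpos c hc)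
      calc N ((taylor α f).coeff (j + 1)) * N (α - c) ^ j
          ≤ N ((taylor α f).coeff (j + 1)) * (N p ^ M * N (α - c₀) ^ j) := by gcongr
        _ = N ((taylor α f).coeff (j + 1)) * N p ^ M * N (α - c₀) ^ j := by ring
        _ ≤ _ := by gcongr
    by_cases hcase : ∃ c ∈ A, N (α - c) ≤ N (α - c₁) ∧ N q * N (α - c) < N (f.eval α)
    · obtain ⟨c, hc, hcc, hlt⟩ := hcase
      refine ⟨c, hc, fun i hi => ?_⟩
      rcases hi.eq_or_lt with rfl | hi
      · rwa [taylor_coeff_one, pow_one]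
      · exact (key c hc hcc i hi).trans hlt
    · push Not at hcase
      exfalso
      obtain ⟨β, hβ, hβ1, hβ2⟩ := hN.newton f α (α - c₁) (hcase c₁ hc₁ le_rfl) (key c₁ hc₁ le_rfl)
      have hβA := hA f hf (by omega) hfA β hβ
      obtain ⟨c, hc, hlt⟩ := hα β hβA
      have hβ3 : N (α - β) = N (β - α) := by rw [← N.map_neg, neg_sub]
      have h7 := hcase c hc (hlt.le.trans (hβ3.trans_le hβ1))
      rw [← hβ2, mul_comm (N q)] at h7
      rw [hβ3] at hlt
      exact absurd (le_of_mul_le_mul_right h7 hqpos) (not_le.2 hlt)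

theorem exists_dom {A : Subfield K} {d : ℕ} (hA : RootClosed A d) {α : K} (hα : NoBest N A α)
    (M : ℕ) {f : K[X]} (hf : f.natDegree ≤ d) (hfA : ∀ i, f.coeff i ∈ A) :
    ∃ c₀ ∈ A, ∀ c ∈ A, N (α - c) ≤ N (α - c₀) → Dom N p M f α (N (α - c)) := by
  by_cases hf0 : f = 0
  · subst hf0
    exact ⟨0, zero_mem A, fun c _ _ i _ => by simp⟩
  obtain ⟨c₁, hc₁, h₁⟩ := exists_dom_lt hN hA hα _ f hf0 rfl hf hfA
  obtain ⟨c₀, hc₀, h₀⟩ := NoBest.shrink hN hα M hc₁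
  refine ⟨c₀, hc₀, fun c _ hcc i hi => ?_⟩
  have hpM := hN.pow_pos M
  calc N ((taylor α f).coeff i) * N (α - c) ^ i
      ≤ N ((taylor α f).coeff i) * (N p ^ M * N (α - c₁)) ^ i := by
        have := N.nonneg ((taylor α f).coeff i)
        have := N.nonneg (α - c)
        have := hcc.trans h₀
        gcongr
    _ = (N p ^ M) ^ i * (N ((taylor α f).coeff i) * N (α - c₁) ^ i) := by rw [mul_pow]; ring
    _ ≤ N p ^ M * N (f.eval α) := by
        have := N.nonneg (α - c₁)
        have := N.nonneg ((taylor α f).coeff i)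
        refine mul_le_mul (pow_le_of_le_one hpM.le (hN.pow_le_one M) (by omega)) (h₁ i hi).le
          (by positivity) hpM.le

/-- If `c` is a best approximation of `α`, then the distance of `α` to `c` is not attained by
elements of `A`. -/
theorem ne_of_best {A : Subfield K} {α c : K} (hα : α ∉ A) (hc : c ∈ A)
    (hbest : ∀ c' ∈ A, N (α - c) ≤ N (α - c')) : ∀ a ∈ A, N (α - c) ≠ N a := by
  intro a ha h
  have hne : α - c ≠ 0 := fun h0 => hα (by rw [sub_eq_zero.1 h0]; exact hc)
  have ha0 : a ≠ 0 := by
    rintro rfl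
    exact hne (N.eq_zero.1 (h.trans (map_zero N)))
  obtain ⟨k, hk⟩ := hN.residue 1 ((α - c) / a) (by
    rw [map_div₀, h, div_self (N.pos ha0).ne'])
  have h1 := hbest (c + k * a) (add_mem hc (mul_mem (natCast_mem A k) ha))
  rw [show α - (c + k * a) = ((α - c) / a - k) * a by field_simp; ring, map_mul, h] at h1
  have := N.pos ha0
  have := hN.p_lt_one
  rw [pow_one] at hk
  nlinarith

theorem pow_ne_of_ne {A : Subfield K} {d : ℕ} (hA : RootClosed A d) {x : K} (hx : x ≠ 0)
    (h : ∀ a ∈ A, N x ≠ N a) (e : ℕ) (he : 1 ≤ e) (hed : e ≤ d) : ∀ a ∈ A, N x ^ e ≠ N a := by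
  intro a ha hxa
  have ha0 : a ≠ 0 := by
    rintro rfl
    rw [map_zero] at hxa
    exact hx (N.eq_zero.1 (pow_eq_zero_iff (by omega) |>.1 hxa))
  obtain ⟨y, hy, hye⟩ := hN.exists_pow_mem ha ha0 he hxa
  refine h y (hA (X ^ e - C (y ^ e)) ?_ ?_ ?_ y (by simp)) hy.symm
  · exact X_pow_sub_C_ne_zero he _
  · rwa [natDegree_X_pow_sub_C]
  · intro i
    rw [coeff_sub, coeff_X_pow, coeff_C]
    refine sub_mem ?_ ?_ <;> split_ifs <;>
      first | exact one_mem A | exact zero_mem A | exact hye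

/-- A polynomial of degree at most `d` is dominated by one of its terms at a point no power of
which has the size of an element of `A`. -/
theorem exists_dominant {A : Subfield K} {d : ℕ} {x : K} (hx : x ≠ 0)
    (h : ∀ e, 1 ≤ e → e ≤ d → ∀ a ∈ A, N x ^ e ≠ N a) {f : K[X]} (hf0 : f ≠ 0)
    (hf : f.natDegree ≤ d) (hfA : ∀ i, f.coeff i ∈ A) :
    ∃ i₀ ≤ d, f.coeff i₀ ≠ 0 ∧ ∀ i, i ≠ i₀ →
      ∀ M : ℕ, N (f.coeff i * x ^ i) < N p ^ M * N (f.coeff i₀ * x ^ i₀) := by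
  obtain ⟨i₀, hi₀, hmax⟩ := Finset.exists_max_image f.support (fun i => N (f.coeff i * x ^ i))
    (by simpa using hf0)
  have hi0 : f.coeff i₀ ≠ 0 := by simpa using hi₀
  have hxpos := N.pos hx
  have hle : ∀ i, f.coeff i ≠ 0 → i ≤ d := fun i hi => (le_natDegree_of_ne_zero hi).trans hf
  refine ⟨i₀, hle _ hi0, hi0, fun i hi M => ?_⟩
  have hpos : 0 < N (f.coeff i₀ * x ^ i₀) := N.pos (by positivity)
  by_cases hfi : f.coeff i = 0
  · rw [hfi, zero_mul, map_zero]
    exact mul_pos (hN.pow_pos M) hpos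
  have h1 := hmax i (by simpa using hfi)
  rcases lt_or_gt_of_ne hi with hlt | hlt
  · obtain ⟨e, rfl⟩ : ∃ e, i₀ = i + e := ⟨i₀ - i, by omega⟩
    have hne : ∀ a ∈ A, N (f.coeff (i + e) * x ^ e) ≠ N a := by
      intro a ha h2
      apply h e (by omega) (by have := hle _ hi0; omega) _ (div_mem ha (hfA (i + e)))
      have := N.pos hi0
      rw [map_div₀, ← h2, map_mul, map_pow]
      field_simp
    have h3 : N (f.coeff i) < N (f.coeff (i + e) * x ^ e) := by
      refine lt_of_le_of_ne ?_ (hne _ (hfA i)).symm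
      rw [pow_add, mul_comm (x ^ i), ← mul_assoc, map_mul, map_mul _ _ (x ^ i), map_pow] at h1
      exact le_of_mul_le_mul_right h1 (by positivity)
    have h4 := (hN.lt_of_lt_of_notMem (hfA i) hne).2 h3 M
    rw [pow_add, mul_comm (x ^ i), ← mul_assoc, map_mul, map_mul _ _ (x ^ i), map_pow, ← mul_assoc]
    exact mul_lt_mul_of_pos_right h4 (by positivity)
  · obtain ⟨e, rfl⟩ : ∃ e, i = i₀ + e := ⟨i - i₀, by omega⟩
    have hne : ∀ a ∈ A, N (f.coeff (i₀ + e) * x ^ e) ≠ N a := by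
      intro a ha h2
      apply h e (by omega) (by have := hle _ hfi; omega) _ (div_mem ha (hfA (i₀ + e)))
      have := N.pos hfi
      rw [map_div₀, ← h2, map_mul, map_pow]
      field_simp
    have h3 : N (f.coeff (i₀ + e) * x ^ e) < N (f.coeff i₀) := by
      refine lt_of_le_of_ne ?_ (hne _ (hfA i₀))
      simp only [pow_add] at h1
      rw [mul_comm (x ^ i₀), ← mul_assoc, map_mul, map_mul _ _ (x ^ i₀), map_pow] at h1
      exact le_of_mul_le_mul_right h1 (by positivity)
    have h4 := (hN.lt_of_lt_of_notMem (hfA i₀) hne).1 h3 M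
    rw [pow_add, mul_comm (x ^ i₀), ← mul_assoc, map_mul, map_mul _ _ (x ^ i₀), map_pow,
      ← mul_assoc]
    exact mul_lt_mul_of_pos_right h4 (by positivity)

/-- The value of a polynomial is close to its dominant term. -/
theorem eval_sub_dominant_le {f : K[X]} {x : K} {i₀ M : ℕ}
    (h : ∀ i, i ≠ i₀ → N (f.coeff i * x ^ i) ≤ N p ^ M * N (f.coeff i₀ * x ^ i₀)) :
    N (f.eval x - f.coeff i₀ * x ^ i₀) ≤ N p ^ M * N (f.coeff i₀ * x ^ i₀) := by
  rw [eval_eq_sum_range' (show f.natDegree < f.natDegree + i₀ + 1 by omega),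
    ← Finset.add_sum_erase _ _ (Finset.mem_range.2 (show i₀ < f.natDegree + i₀ + 1 by omega)),
    add_sub_cancel_left]
  exact hN.sum_le _ _ (mul_nonneg (hN.pow_pos M).le (N.nonneg _)) fun i hi =>
    h i (Finset.ne_of_mem_erase hi)

end

end OneSided
end PadicLike

namespace PadicLike

section Existential

variable {p : ℕ} {K R : Type*} [Field K] [Field R] [LinearOrder R] [IsStrictOrderedRing R]
  {N : AbsoluteValue K R}
variable (hN : PadicLike p N)
include hN

theorem mem_of_pow_mem {A : Subfield K} (hA : ∀ d, RootClosed A d) {w : K} {e : ℕ} (he : 0 < e)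
    (hw : w ^ e ∈ A) : w ∈ A := by
  have := hN.p_pos
  refine hA e (X ^ e - C (w ^ e)) (X_pow_sub_C_ne_zero he _) (by rw [natDegree_X_pow_sub_C]) ?_ w
    (by simp)
  intro i
  rw [coeff_sub, coeff_X_pow, coeff_C]
  refine sub_mem ?_ ?_ <;> split_ifs <;>
    first | exact one_mem A | exact zero_mem A | exact hw

theorem isNthPow_mul_natCast_pow {n : ℕ} {x w : K} {q l : ℕ} (hx : x = q * w ^ n) {b : K}
    (hb : b ≠ 0) (hq : q ≠ 0) :
    IsNthPow n (x / q) ∧ IsNthPow n (b * x / (b * q * (p : K) ^ (n * l))) ∧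
      IsNthPow n (b * x / (b * q * ((p : K) ^ (n * l))⁻¹)) := by
  have hq' := hN.natCast_ne_zero hq
  have hp := hN.p_ne_zero
  refine ⟨⟨w, ?_⟩, ⟨w / p ^ l, ?_⟩, ⟨w * p ^ l, ?_⟩⟩
  · rw [hx]; field_simp
  · rw [hx, div_pow, ← pow_mul, mul_comm l]; field_simp
  · rw [hx, mul_pow, ← pow_mul, mul_comm l]; field_simp

/-- If the size of `α` is not attained by elements of `A`, there are elements of `A` realizing a
finite part of the cut of `α` that differ from `α` by an `n`-th power. -/
theorem exists_mem_cut {A : Subfield K} {α : K} (hα0 : α ≠ 0) (hα : ∀ a ∈ A, N α ≠ N a) {n : ℕ}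
    (hn : 0 < n) (B : Finset A) (M : ℕ) :
    ∃ t ∈ A, t ≠ 0 ∧ IsNthPow n (α / t) ∧ ∀ b ∈ B, b ≠ 0 →
      (N α < N (b : K) → N t ≤ N p ^ M * N (b : K)) ∧
      (N (b : K) < N α → N (b : K) ≤ N p ^ M * N t) := by
  classical
  have hpM := hN.pow_pos M
  by_cases hlow : (B.filter fun b : A => b ≠ 0 ∧ N (b : K) < N α).Nonempty
  · obtain ⟨b, hb, hmax⟩ := Finset.exists_max_image _ (fun b : A => N (b : K)) hlow
    obtain ⟨hbB, hb0, hbα⟩ := Finset.mem_filter.1 hb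
    have hb0' : (b : K) ≠ 0 := by simpa using hb0
    obtain ⟨q, hq, w, hw⟩ := hN.rep n hn (α / b) (div_ne_zero hα0 hb0')
    obtain ⟨L, hL⟩ := hN.natCast_ge q hq
    have hpk := hN.pow_pos (n * (M + L))
    refine ⟨b * q * ((p : K) ^ (n * (M + L)))⁻¹, mul_mem (mul_mem b.2 (natCast_mem A q))
      (inv_mem (pow_mem (natCast_mem A p) _)), ?_, ?_, ?_⟩
    · have := hN.natCast_ne_zero hq
      have := hN.p_ne_zero
      positivity
    · have := (hN.isNthPow_mul_natCast_pow (l := M + L) hw hb0' hq).2.2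
      rwa [mul_div_cancel₀ _ hb0'] at this
    · intro b' hb' hb'0
      simp only [map_mul, map_inv₀, map_pow]
      have hbpos := N.pos hb0'
      constructor
      · intro hlt
        have h1 := (hN.lt_of_lt_of_notMem b'.2 hα).1 hlt (n * (M + L) + M)
        have h2 := hN.natCast_le_one q
        rw [← div_eq_mul_inv, div_le_iff₀ hpk]
        calc N (b : K) * N q ≤ N (b : K) * 1 := by gcongr
          _ ≤ N p ^ (n * (M + L) + M) * N (b' : K) := by rw [mul_one]; exact (hbα.trans h1).le
          _ = _ := by rw [pow_add]; ring
      · intro hlt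
        have h1 := hmax b' (Finset.mem_filter.2 ⟨hb', hb'0, hlt⟩)
        rw [← div_eq_mul_inv, ← mul_div_assoc, le_div_iff₀ hpk]
        calc N (b' : K) * N p ^ (n * (M + L)) ≤ N (b : K) * N p ^ (M + L) := by
              have h3 := hN.pow_le_pow (M := M + L) (M' := n * (M + L)) (Nat.le_mul_of_pos_left _ hn)
              gcongr
          _ ≤ N (b : K) * (N p ^ M * N q) := by rw [pow_add]; gcongr
          _ = _ := by ring
  have hlow' : ∀ b ∈ B, b ≠ 0 → ¬ N (b : K) < N α := fun b hb hb0 hlt =>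
    hlow ⟨b, Finset.mem_filter.2 ⟨hb, hb0, hlt⟩⟩
  by_cases hup : (B.filter fun b : A => b ≠ 0).Nonempty
  · obtain ⟨b, hb, hmin⟩ := Finset.exists_min_image _ (fun b : A => N (b : K)) hup
    obtain ⟨hbB, hb0⟩ := Finset.mem_filter.1 hb
    have hb0' : (b : K) ≠ 0 := by simpa using hb0
    obtain ⟨q, hq, w, hw⟩ := hN.rep n hn (α / b) (div_ne_zero hα0 hb0')
    refine ⟨b * q * p ^ (n * M), mul_mem (mul_mem b.2 (natCast_mem A q))
      (pow_mem (natCast_mem A p) _), ?_, ?_, ?_⟩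
    · have := hN.natCast_ne_zero hq
      have := hN.p_ne_zero
      positivity
    · have := (hN.isNthPow_mul_natCast_pow (l := M) hw hb0' hq).2.1
      rwa [mul_div_cancel₀ _ hb0'] at this
    · intro b' hb' hb'0
      refine ⟨fun _ => ?_, fun hlt => absurd hlt (hlow' b' hb' hb'0)⟩
      have h1 := hmin b' (Finset.mem_filter.2 ⟨hb', hb'0⟩)
      have h2 := hN.natCast_le_one q
      have h3 := hN.pow_le_pow (M := M) (M' := n * M) (Nat.le_mul_of_pos_left _ hn)
      have hbpos := N.pos hb0'
      simp only [map_mul, map_pow]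
      calc N (b : K) * N q * N p ^ (n * M) ≤ N (b' : K) * 1 * N p ^ M := by gcongr
        _ = _ := by ring
  · obtain ⟨q, hq, w, hw⟩ := hN.rep n hn α hα0
    exact ⟨q, natCast_mem A q, hN.natCast_ne_zero hq,
      (hN.isNthPow_mul_natCast_pow (l := 0) hw one_ne_zero hq).1, fun b hb hb0 =>
      absurd ⟨b, Finset.mem_filter.2 ⟨hb, hb0⟩⟩ hup⟩

/-- If the size of `α` is not attained by elements of the relatively algebraically closed subfield
`A`, there is a net in `A` realizing the cut of `α` and differing from `α` by `n`-th powers. -/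
theorem exists_net {A : Subfield K} (hA : ∀ d, RootClosed A d) {α : K} (hα0 : α ≠ 0)
    (hα : ∀ a ∈ A, N α ≠ N a) {n : ℕ} (hn : 0 < n) :
    ∃ t : Finset A × ℕ → K, (∀ i, t i ∈ A ∧ t i ≠ 0 ∧ IsNthPow n (α / t i)) ∧
      (∀ a ∈ A, ∀ e, 0 < e → N (a * α ^ e) < 1 → ∀ M, ∀ᶠ i in atTop, N (a * t i ^ e) ≤ N p ^ M) ∧
      (∀ a ∈ A, ∀ e, 0 < e → N a < N (α ^ e) → ∀ M, ∀ᶠ i in atTop, N a ≤ N p ^ M * N (t i ^ e)) := by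
  classical
  choose t htA ht0 htn ht using fun i : Finset A × ℕ => hN.exists_mem_cut hα0 hα hn i.1 i.2
  have hev : ∀ b ∈ A, b ≠ 0 → ∀ M, ∀ᶠ i in atTop,
      (N α < N b → N (t i) ≤ N p ^ M * N b) ∧ (N b < N α → N b ≤ N p ^ M * N (t i)) := by
    intro b hb hb0 M
    filter_upwards [eventually_ge_atTop (({⟨b, hb⟩} : Finset A), M)] with i hi
    have h1 := ht i ⟨b, hb⟩ (hi.1 (Finset.mem_singleton_self _))
      (by simpa [Subtype.ext_iff] using hb0)
    have h2 := hN.pow_le_pow hi.2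
    refine ⟨fun h => (h1.1 h).trans ?_, fun h => (h1.2 h).trans ?_⟩ <;>
      exact mul_le_mul_of_nonneg_right h2 (N.nonneg _)
  have hαe : ∀ e, 0 < e → ∀ a ∈ A, N α ^ e ≠ N a := fun e he =>
    pow_ne_of_ne hN (hA e) hα0 hα e he le_rfl
  have hmem : ∀ a ∈ A, ∀ e, 0 < e → ∀ q : ℕ, q ≠ 0 → ∀ w : K, a = q * w ^ e → w ∈ A := by
    intro a ha e he q hq w hw
    refine hN.mem_of_pow_mem hA he ?_
    rw [← mul_div_cancel_left₀ (w ^ e) (hN.natCast_ne_zero hq), ← hw]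
    exact div_mem ha (natCast_mem A q)
  refine ⟨t, fun i => ⟨htA i, ht0 i, htn i⟩, fun a ha e he h M => ?_, fun a ha e he h M => ?_⟩
  · by_cases ha0 : a = 0
    · simp [ha0, hN.p_pos.le]
    obtain ⟨q, hq, w, hw⟩ := hN.rep e he a⁻¹ (inv_ne_zero ha0)
    obtain ⟨L, hL⟩ := hN.natCast_ge q hq
    have hwA := hmem _ (inv_mem ha) e he q hq w hw
    have hw0 : w ≠ 0 := by
      rintro rfl
      rw [zero_pow he.ne', mul_zero] at hw
      exact inv_ne_zero ha0 hw
    have hapos := N.pos ha0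
    have h1 : N α < N w := by
      refine lt_of_pow_lt_pow_left₀ e (N.nonneg _) ?_
      rw [map_mul, map_pow, ← lt_div_iff₀' hapos, one_div, ← map_inv₀, hw, map_mul, map_pow] at h
      exact h.trans_le (mul_le_of_le_one_left (pow_nonneg (N.nonneg _) _) (hN.natCast_le_one q))
    filter_upwards [hev w hwA hw0 (M + L)] with i hi
    have h2 := hi.1 h1
    have hqpos := (hN.pow_pos L).trans_le hL
    have hML := hN.pow_pos (M + L)
    have h3 : N a * (N q * N w ^ e) = 1 := by
      rw [← map_pow, ← map_mul, ← hw, ← map_mul, mul_inv_cancel₀ ha0, map_one]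
    have h4 : (N p ^ (M + L)) ^ e ≤ N p ^ M * N q := by
      refine (pow_le_of_le_one hML.le (hN.pow_le_one _) he.ne').trans ?_
      rw [pow_add]
      exact mul_le_mul_of_nonneg_left hL (hN.pow_pos M).le
    rw [map_mul, map_pow]
    calc N a * N (t i) ^ e ≤ N a * (N p ^ (M + L) * N w) ^ e := by gcongr
      _ = (N p ^ (M + L)) ^ e * (N a * N w ^ e) := by rw [mul_pow]; ring
      _ ≤ N p ^ M * N q * (N a * N w ^ e) := by
        have := N.nonneg w
        gcongr
      _ = N p ^ M * (N a * (N q * N w ^ e)) := by ring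
      _ = N p ^ M := by rw [h3, mul_one]
  · by_cases ha0 : a = 0
    · refine Eventually.of_forall fun i => ?_
      rw [ha0, map_zero]
      exact mul_nonneg (hN.pow_pos M).le (N.nonneg _)
    obtain ⟨q, hq, w, hw⟩ := hN.rep e he a ha0
    obtain ⟨L, hL⟩ := hN.natCast_ge q hq
    have hwA := hmem _ ha e he q hq w hw
    have hw0 : w ≠ 0 := by
      rintro rfl
      rw [zero_pow he.ne', mul_zero] at hw
      exact ha0 hw
    have hqpos := (hN.pow_pos L).trans_le hL
    have h1 : N w < N α := by
      refine lt_of_pow_lt_pow_left₀ e (N.nonneg _) ?_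
      have h5 := (hN.lt_of_lt_of_notMem (b := α ^ e) ha
        (by rw [map_pow]; exact hαe e he)).2 h L
      rw [hw, map_mul, map_pow, map_pow] at h5
      have h6 : N q * N w ^ e < N q * N α ^ e :=
        h5.trans_le (mul_le_mul_of_nonneg_right hL (pow_nonneg (N.nonneg _) _))
      exact lt_of_mul_lt_mul_left h6 hqpos.le
    filter_upwards [hev w hwA hw0 M] with i hi
    have h2 := hi.2 h1
    have hpM := hN.pow_pos M
    have := N.nonneg (t i)
    have := N.nonneg w
    rw [hw, map_mul, map_pow, map_pow]
    calc N q * N w ^ e ≤ 1 * (N p ^ M * N (t i)) ^ e := by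
          have := hN.natCast_le_one q
          gcongr
      _ = (N p ^ M) ^ e * N (t i) ^ e := by rw [one_mul, mul_pow]
      _ ≤ _ := by
        have := pow_le_of_le_one hpM.le (hN.pow_le_one M) he.ne'
        gcongr

/-- A relatively algebraically closed subfield is existentially closed with respect to power
conditions in one variable. -/
theorem exists_mem_isNthPow_iff {A : Subfield K} (hA : ∀ d, RootClosed A d) (α : K)
    (T : Finset (K[X] × ℕ)) (hT : ∀ g ∈ T, 0 < g.2 ∧ ∀ i, g.1.coeff i ∈ A) :
    ∃ c ∈ A, ∀ g ∈ T, (IsNthPow g.2 (g.1.eval c) ↔ IsNthPow g.2 (g.1.eval α)) := by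
  classical
  by_cases hαA : α ∈ A
  · exact ⟨α, hαA, fun _ _ => Iff.rfl⟩
  have hM : ∃ M : ℕ, 1 ≤ M ∧ ∀ g ∈ T, ∀ a b,
      N (a - b) ≤ N p ^ M * N b → (IsNthPow g.2 a ↔ IsNthPow g.2 b) := by
    choose! M hM using hN.exists_isNthPow_congr
    refine ⟨T.sup (fun g => M g.2) + 1, by omega, fun g hg => hM g.2 (hT g hg).1 _ ?_⟩
    have := Finset.le_sup (f := fun g : K[X] × ℕ => M g.2) hg
    omega
  obtain ⟨M, hM1, hM⟩ := hM
  by_cases hbest : NoBest N A α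
  · have hD : ∃ c ∈ A, ∀ g ∈ T, Dom N p M g.1 α (N (α - c)) := by
      choose! c₀ hc₀A hc₀ using fun g hg =>
        exists_dom hN (hA _) hbest M (f := g) le_rfl hg
      rcases T.eq_empty_or_nonempty with rfl | hne
      · exact ⟨0, zero_mem A, by simp⟩
      obtain ⟨g₀, hg₀, hmin⟩ := Finset.exists_min_image T (fun g => N (α - c₀ g.1)) hne
      exact ⟨c₀ g₀.1, hc₀A _ (hT g₀ hg₀).2, fun g hg =>
        hc₀ _ (hT g hg).2 _ (hc₀A _ (hT g₀ hg₀).2) (hmin g hg)⟩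
    obtain ⟨c, hc, hcD⟩ := hD
    refine ⟨c, hc, fun g hg => hM g hg _ _ ?_⟩
    have := hN.eval_sub_le (hcD g hg) (z := c - α) (by rw [← N.map_neg, neg_sub])
    rwa [add_sub_cancel] at this
  · simp only [NoBest, not_forall, not_exists, not_and, not_lt] at hbest
    obtain ⟨c, hc, hbest⟩ := hbest
    have hne := ne_of_best hN hαA hc hbest
    have hx0 : α - c ≠ 0 := fun h0 => hαA (by rw [sub_eq_zero.1 h0]; exact hc)
    set x := α - c with hx
    obtain ⟨t, ht, ht1, ht2⟩ := hN.exists_net hA hx0 hne (n := ∏ g ∈ T, g.2)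
      (Finset.prod_pos fun g hg => (hT g hg).1)
    have hev : ∀ g ∈ T, ∀ᶠ i in atTop,
        (IsNthPow g.2 (g.1.eval (c + t i)) ↔ IsNthPow g.2 (g.1.eval α)) := by
      intro g hg
      have hgA := (hT g hg).2
      by_cases hg0 : g.1 = 0
      · simp [hg0]
      have hfA := taylor_coeff_mem hgA hc
      set f := taylor c g.1 with hf
      have hf0 : f ≠ 0 := by
        rw [hf, Ne, taylor_eq_zero]
        exact hg0
      have hfe : ∀ z, g.1.eval (c + z) = f.eval z := fun z => by rw [hf, taylor_eval, add_comm]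
      obtain ⟨i₀, -, hi0, hdom⟩ := exists_dominant hN (d := f.natDegree) hx0 (fun e he _ =>
        pow_ne_of_ne hN (hA e) hx0 hne e he le_rfl) hf0 le_rfl hfA
      have hi0pos := N.pos hi0
      have hall : ∀ᶠ i in atTop, ∀ j ∈ Finset.range (f.natDegree + 1), j ≠ i₀ →
          N (f.coeff j * t i ^ j) ≤ N p ^ M * N (f.coeff i₀ * t i ^ i₀) := by
        rw [eventually_all_finset]
        intro j _
        by_cases hj : j = i₀
        · simp [hj]
        have hd := hdom j hj 0
        rw [pow_zero, one_mul] at hd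
        have hdiv := div_mem (hfA j) (hfA i₀)
        have hxpos := N.pos hx0
        rcases lt_or_gt_of_ne hj with hlt | hlt
        · obtain ⟨e, rfl⟩ : ∃ e, i₀ = j + e := ⟨i₀ - j, by omega⟩
          have h3 : N (f.coeff j / f.coeff (j + e)) < N (x ^ e) := by
            simp only [map_mul, map_pow, map_div₀, pow_add] at hd ⊢
            rw [div_lt_iff₀ hi0pos]
            rw [mul_comm (N x ^ j), ← mul_assoc] at hd
            rw [mul_comm]
            exact lt_of_mul_lt_mul_right hd (pow_nonneg hxpos.le _)
          filter_upwards [ht2 _ hdiv e (by omega) h3 M] with i hi _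
          rw [map_div₀, div_le_iff₀ hi0pos] at hi
          simp only [map_mul, map_pow, pow_add] at hi ⊢
          calc N (f.coeff j) * N (t i) ^ j ≤ N p ^ M * N (t i) ^ e * N (f.coeff (j + e)) *
                N (t i) ^ j := by
                have := N.nonneg (t i)
                gcongr
            _ = _ := by ring
        · obtain ⟨e, rfl⟩ : ∃ e, j = i₀ + e := ⟨j - i₀, by omega⟩
          have h3 : N (f.coeff (i₀ + e) / f.coeff i₀ * x ^ e) < 1 := by
            simp only [map_mul, map_pow, map_div₀, pow_add] at hd ⊢
            rw [div_mul_eq_mul_div, div_lt_one hi0pos]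
            rw [mul_comm (N x ^ i₀), ← mul_assoc] at hd
            exact lt_of_mul_lt_mul_right hd (pow_nonneg hxpos.le _)
          filter_upwards [ht1 _ hdiv e (by omega) h3 M] with i hi _
          simp only [map_mul, map_pow, map_div₀, pow_add] at hi ⊢
          rw [div_mul_eq_mul_div, div_le_iff₀ hi0pos] at hi
          calc N (f.coeff (i₀ + e)) * (N (t i) ^ i₀ * N (t i) ^ e)
              = N (f.coeff (i₀ + e)) * N (t i) ^ e * N (t i) ^ i₀ := by ring
            _ ≤ N p ^ M * N (f.coeff i₀) * N (t i) ^ i₀ := by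
                have := N.nonneg (t i)
                gcongr
            _ = _ := by ring
      filter_upwards [hall] with i hi
      have hi' : ∀ j, j ≠ i₀ →
          N (f.coeff j * t i ^ j) ≤ N p ^ M * N (f.coeff i₀ * t i ^ i₀) := by
        intro j hj
        by_cases hjr : j ∈ Finset.range (f.natDegree + 1)
        · exact hi j hjr hj
        · rw [coeff_eq_zero_of_natDegree_lt (by simpa [Nat.lt_succ_iff] using hjr), zero_mul,
            map_zero]
          exact mul_nonneg (hN.pow_pos M).le (N.nonneg _)
      have e1 := hM g hg _ _ (eval_sub_dominant_le hN hi')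
      have e2 := hM g hg _ _ (eval_sub_dominant_le hN fun j hj => (hdom j hj M).le)
      rw [hfe, show α = c + x by rw [hx, add_sub_cancel], hfe, e1, e2]
      obtain ⟨-, ht0, w, hw⟩ := ht i
      obtain ⟨k, hk⟩ := Finset.dvd_prod_of_mem (fun g : K[X] × ℕ => g.2) hg
      have hxt : x = t i * (w ^ k) ^ g.2 := by
        rw [← pow_mul, mul_comm k, ← hk, hw, mul_div_cancel₀ _ ht0]
      have hwk : w ^ k ≠ 0 := by
        intro h0
        rw [h0, zero_pow (hT g hg).1.ne', mul_zero] at hxt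
        exact hx0 hxt
      constructor
      · rintro ⟨y, hy⟩
        refine ⟨y * (w ^ k) ^ i₀, ?_⟩
        rw [mul_pow, hy, hxt, mul_pow]
        ring
      · rintro ⟨y, hy⟩
        refine ⟨y / (w ^ k) ^ i₀, ?_⟩
        rw [div_pow, hy, hxt, div_eq_iff (pow_ne_zero _ (pow_ne_zero _ hwk))]
        ring
    obtain ⟨i, hi⟩ := ((eventually_all_finset T).2 hev).exists
    exact ⟨c + t i, add_mem hc (ht i).1, hi⟩

end Existential
end PadicLike

theorem isNthPow_mul_pow_iff {K : Type*} [Field K] {n : ℕ} {a y : K} (hy : y ≠ 0) :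
    IsNthPow n (a * y ^ n) ↔ IsNthPow n a := by
  constructor
  · rintro ⟨z, hz⟩
    exact ⟨z / y, by rw [div_pow, hz, mul_div_cancel_right₀ _ (pow_ne_zero _ hy)]⟩
  · rintro ⟨z, hz⟩
    exact ⟨z * y, by rw [mul_pow, hz]⟩

namespace PadicLike

theorem eq_zero_iff {p : ℕ} {K R : Type*} [Field K] [Field R] [LinearOrder R]
    [IsStrictOrderedRing R] {N : AbsoluteValue K R} (hN : PadicLike p N) (a : K) :
    a = 0 ↔ IsNthPow 2 a ∧ IsNthPow 2 (p * a) := by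
  constructor
  · rintro rfl
    exact ⟨⟨0, by simp⟩, ⟨0, by simp⟩⟩
  · rintro ⟨⟨y, rfl⟩, z, hz⟩
    by_contra hy
    have hy : y ≠ 0 := fun h => hy (by simp [h])
    have hpow : (z / y) ^ 2 = p := by rw [div_pow, hz]; field_simp
    have h1 : N (z / y) ^ 2 = N p := by rw [← map_pow, hpow]
    have h2 : N (z / y) < 1 := by
      rw [← pow_lt_one_iff_of_nonneg (N.nonneg _) two_ne_zero, h1]
      exact hN.p_lt_one
    have h3 := hN.discrete _ h2
    have h4 := hN.p_pos
    have h5 := N.nonneg (z / y)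
    nlinarith [hN.p_lt_one]

section Extension

variable {p : ℕ} {K R K' R' : Type*} [Field K] [Field R] [LinearOrder R] [IsStrictOrderedRing R]
  [Field K'] [Field R'] [LinearOrder R'] [IsStrictOrderedRing R']
  {N : AbsoluteValue K R} {N' : AbsoluteValue K' R'}

/-- The correspondence given by `Γ` respects power conditions. -/
def RespectsPow (Γ : Subring (K × K')) : Prop :=
  ∀ a ∈ Γ, ∀ n, 0 < n → (IsNthPow n a.1 ↔ IsNthPow n a.2)

theorem exists_maximal_respectsPow {Γ₀ : Subring (K × K')} (h : RespectsPow Γ₀) :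
    ∃ Γ, Γ₀ ≤ Γ ∧ Maximal RespectsPow Γ := by
  refine zorn_le_nonempty₀ {Γ : Subring (K × K') | RespectsPow Γ} (fun c hc hch Γ hΓ => ?_) Γ₀ h
  refine ⟨sSup c, fun a ha => ?_, fun _ => le_sSup⟩
  rw [Subring.mem_sSup_of_directedOn ⟨Γ, hΓ⟩ hch.directedOn] at ha
  obtain ⟨Δ, hΔ, ha⟩ := ha
  exact hc hΔ a ha

section
variable {Γ : Subring (K × K')}

/-- The first projection. -/
def fstHom (Γ : Subring (K × K')) : Γ →+* K := (RingHom.fst K K').comp Γ.subtype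

/-- The second projection. -/
def sndHom (Γ : Subring (K × K')) : Γ →+* K' := (RingHom.snd K K').comp Γ.subtype

theorem RespectsPow.iff (hΓ : RespectsPow Γ) (a : Γ) {n : ℕ} (hn : 0 < n) :
    IsNthPow n (fstHom Γ a) ↔ IsNthPow n (sndHom Γ a) := hΓ a a.2 n hn

variable (hN : PadicLike p N) (hN' : PadicLike p N')
include hN hN'

theorem fst_eq_zero_iff (hΓ : RespectsPow Γ) (a : Γ) : fstHom Γ a = 0 ↔ sndHom Γ a = 0 := by
  rw [hN.eq_zero_iff, hN'.eq_zero_iff, ← map_natCast (fstHom Γ), ← map_natCast (sndHom Γ),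
    ← map_mul, ← map_mul, hΓ.iff a two_pos, hΓ.iff _ two_pos]

theorem exists_inv (hΓ : Maximal RespectsPow Γ) (a : Γ) :
    ∃ b : Γ, fstHom Γ b = (fstHom Γ a)⁻¹ ∧ sndHom Γ b = (sndHom Γ a)⁻¹ := by
  by_cases h0 : fstHom Γ a = 0
  · have h0' := (fst_eq_zero_iff hN hN' hΓ.1 a).1 h0
    exact ⟨0, by simp [h0], by simp [h0']⟩
  have h0' := mt (fst_eq_zero_iff hN hN' hΓ.1 a).2 h0
  let Δ : Subring (K × K') :=
    { carrier := {b | ∃ k : ℕ, (a : K × K') ^ k * b ∈ Γ}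
      mul_mem' := by
        rintro b c ⟨k, hk⟩ ⟨l, hl⟩
        exact ⟨k + l, by convert mul_mem hk hl using 1; ring⟩
      one_mem' := ⟨0, by simp⟩
      add_mem' := by
        rintro b c ⟨k, hk⟩ ⟨l, hl⟩
        refine ⟨k + l, ?_⟩
        convert add_mem (mul_mem (pow_mem a.2 l) hk) (mul_mem (pow_mem a.2 k) hl) using 1
        ring
      zero_mem' := ⟨0, by simp⟩
      neg_mem' := by
        rintro b ⟨k, hk⟩
        exact ⟨k, by convert neg_mem hk using 1; ring⟩ }
  have hΔ : RespectsPow Δ := by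
    rintro b ⟨k, hk⟩ n hn
    have h1 : (a : K × K') ^ (k * n) * b ∈ Γ := by
      obtain ⟨m, rfl⟩ : ∃ m, n = m + 1 := ⟨n - 1, by omega⟩
      convert mul_mem (pow_mem a.2 (k * m)) hk using 1
      ring
    have h2 := hΓ.1 _ h1 n hn
    change (a : K × K').1 ≠ 0 at h0
    change (a : K × K').2 ≠ 0 at h0'
    rw [Prod.fst_mul, Prod.snd_mul, Prod.pow_fst, Prod.pow_snd, mul_comm, mul_comm _ b.2, pow_mul,
      pow_mul, isNthPow_mul_pow_iff (pow_ne_zero k h0), isNthPow_mul_pow_iff (pow_ne_zero k h0')]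
      at h2
    exact h2
  have hle : Γ ≤ Δ := fun b hb => ⟨0, by simpa using hb⟩
  have hmem : ((fstHom Γ a)⁻¹, (sndHom Γ a)⁻¹) ∈ Δ := by
    refine ⟨1, ?_⟩
    convert one_mem Γ
    rw [pow_one]
    ext
    · exact mul_inv_cancel₀ h0
    · exact mul_inv_cancel₀ h0'
  exact ⟨⟨_, hΓ.2 hΔ hle hmem⟩, rfl, rfl⟩

/-- Comparison of sizes is preserved by the correspondence. -/
theorem le_iff_le (hΓ : Maximal RespectsPow Γ) (a b : Γ) :
    N (fstHom Γ a) ≤ N (fstHom Γ b) ↔ N' (sndHom Γ a) ≤ N' (sndHom Γ b) := by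
  by_cases h0 : fstHom Γ b = 0
  · have h0' := (fst_eq_zero_iff hN hN' hΓ.1 b).1 h0
    have h1 := fst_eq_zero_iff hN hN' hΓ.1 a
    rw [h0, h0', map_zero, map_zero, N.nonpos_iff, N'.nonpos_iff, h1]
  have h0' := mt (fst_eq_zero_iff hN hN' hΓ.1 b).2 h0
  obtain ⟨c, hc, hc'⟩ := exists_inv hN hN' hΓ b
  have h1 := hΓ.1.iff (1 + (p : Γ) ^ 3 * (a * c) ^ 4) two_pos
  simp only [map_add, map_mul, map_pow, map_natCast, map_one, hc, hc'] at h1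
  rw [← hN.le_one_iff, ← hN'.le_one_iff, ← div_eq_mul_inv, ← div_eq_mul_inv, map_div₀, map_div₀,
    div_le_one (N.pos h0), div_le_one (N'.pos h0')] at h1
  exact h1

theorem lt_iff_lt (hΓ : Maximal RespectsPow Γ) (a b : Γ) :
    N (fstHom Γ a) < N (fstHom Γ b) ↔ N' (sndHom Γ a) < N' (sndHom Γ b) := by
  rw [← not_le, ← not_le, le_iff_le hN hN' hΓ]

/-- The domain of a maximal correspondence. -/
def fstField (hΓ : Maximal RespectsPow Γ) : Subfield K :=
  { (fstHom Γ).range with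
    inv_mem' := by
      rintro _ ⟨a, rfl⟩
      obtain ⟨b, hb, -⟩ := exists_inv hN hN' hΓ a
      exact ⟨b, hb⟩ }

theorem mem_fstField (hΓ : Maximal RespectsPow Γ) {x : K} :
    x ∈ fstField hN hN' hΓ ↔ ∃ a, fstHom Γ a = x := Iff.rfl

theorem mem_fstField_of_root (hΓ : Maximal RespectsPow Γ) {F : Γ[X]} (hF : F.Monic) {α : K}
    (hα : (F.map (fstHom Γ)).IsRoot α)
    (h : ∀ T : Finset (Γ[X] × ℕ), (∀ g ∈ T, 0 < g.2 ∧ g.1.natDegree < F.natDegree) →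
      ∃ α', (F.map (sndHom Γ)).IsRoot α' ∧ ∀ g ∈ T,
        (IsNthPow g.2 ((g.1.map (fstHom Γ)).eval α) ↔
          IsNthPow g.2 ((g.1.map (sndHom Γ)).eval α'))) : α ∈ fstField hN hN' hΓ := by
  classical
  have hF1 : F ≠ 1 := by
    rintro rfl
    simp at hα
  have hroot : ∃ α', (F.map (sndHom Γ)).IsRoot α' ∧ ∀ g : Γ[X] × ℕ,
      0 < g.2 ∧ g.1.natDegree < F.natDegree → (IsNthPow g.2 ((g.1.map (fstHom Γ)).eval α) ↔
          IsNthPow g.2 ((g.1.map (sndHom Γ)).eval α')) := by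
    by_contra! hcon
    choose! G hG hG' using hcon
    have hF'0 : F.map (sndHom Γ) ≠ 0 := (hF.map _).ne_zero
    obtain ⟨α', hα', h'⟩ := h (((F.map (sndHom Γ)).roots.toFinset).image G) (by
      intro g hg
      obtain ⟨β, hβ, rfl⟩ := Finset.mem_image.1 hg
      rw [Multiset.mem_toFinset, mem_roots hF'0] at hβ
      exact hG β hβ)
    have := h' (G α') (Finset.mem_image_of_mem _ (by
      rw [Multiset.mem_toFinset, mem_roots hF'0]; exact hα'))
    have h2 := hG' α' hα'
    tauto
  obtain ⟨α', hα', h'⟩ := hroot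
  let Δ : Subring (K × K') :=
    (RingHom.prod (eval₂RingHom (fstHom Γ) α) (eval₂RingHom (sndHom Γ) α')).range
  have hΔ : RespectsPow Δ := by
    rintro _ ⟨g, rfl⟩ n hn
    have h1 := h' (g %ₘ F, n) ⟨hn, natDegree_modByMonic_lt g hF hF1⟩
    simp only [IsRoot, eval_map] at hα hα' h1
    have h2 : eval₂ (fstHom Γ) α g = eval₂ (fstHom Γ) α (g %ₘ F) := by
      conv_lhs => rw [← modByMonic_add_div g F]
      rw [eval₂_add, eval₂_mul, hα, zero_mul, add_zero]
    have h3 : eval₂ (sndHom Γ) α' g = eval₂ (sndHom Γ) α' (g %ₘ F) := by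
      conv_lhs => rw [← modByMonic_add_div g F]
      rw [eval₂_add, eval₂_mul, hα', zero_mul, add_zero]
    simpa only [RingHom.prod_apply, coe_eval₂RingHom, h2, h3] using h1
  have hle : Γ ≤ Δ := fun b hb => ⟨C ⟨b, hb⟩, by
    simp only [RingHom.prod_apply, coe_eval₂RingHom, eval₂_C]; rfl⟩
  have hmem : (α, α') ∈ Δ :=
    ⟨X, by simp only [RingHom.prod_apply, coe_eval₂RingHom, eval₂_X]⟩
  exact ⟨⟨_, hΓ.2 hΔ hle hmem⟩, rfl⟩

end

end Extension
end PadicLike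

namespace PadicLike

section Extension

variable {p : ℕ} {K R K' R' : Type*} [Field K] [Field R] [LinearOrder R] [IsStrictOrderedRing R]
  [Field K'] [Field R'] [LinearOrder R'] [IsStrictOrderedRing R']
  {N : AbsoluteValue K R} {N' : AbsoluteValue K' R'} {Γ : Subring (K × K')}
variable (hN : PadicLike p N) (hN' : PadicLike p N')

include hN in
theorem exists_isNthPow_congr_finset {ι : Type*} (T : Finset ι) (f : ι → ℕ)
    (hf : ∀ i ∈ T, 0 < f i) : ∃ M : ℕ, ∀ M' ≥ M, ∀ i ∈ T, ∀ a b,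
      N (a - b) ≤ N p ^ M' * N b → (IsNthPow (f i) a ↔ IsNthPow (f i) b) := by
  choose! M hM using hN.exists_isNthPow_congr
  exact ⟨T.sup (fun i => M (f i)), fun M' hM' i hi =>
    hM (f i) (hf i hi) _ ((Finset.le_sup (f := fun i => M (f i)) hi).trans hM')⟩

include hN in
theorem exists_pow_le_natCast (n : ℕ) : ∃ M : ℕ, ∀ i ≤ n, i ≠ 0 → N p ^ M ≤ N (i : K) := by
  choose! M hM using hN.natCast_ge
  refine ⟨(Finset.range (n + 1)).sup M, fun i hi hi0 => (hN.pow_le_pow ?_).trans (hM i hi0)⟩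
  exact Finset.le_sup (f := M) (Finset.mem_range.2 (by omega))

include hN in
/-- If the derivative of `f` is dominated by its value at `c`, then `f` is close to being linear
near `c`. -/
theorem Dom.of_derivative {M n : ℕ} (hM : ∀ i ≤ n, i ≠ 0 → N p ^ M ≤ N (i : K)) {f : K[X]}
    (hf : f.natDegree ≤ n) {c : K} {ρ : R} (hρ : 0 < ρ) (hc : f.derivative.eval c ≠ 0)
    (h : Dom N p (M + 1) f.derivative c ρ) (i : ℕ) (hi : 2 ≤ i) :
    N ((taylor c f).coeff i) * ρ ^ i < N (f.derivative.eval c) * ρ := by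
  have hqpos := N.pos hc
  rcases lt_or_ge n i with hni | hni
  · rw [coeff_eq_zero_of_natDegree_lt (by rw [natDegree_taylor]; omega), map_zero, zero_mul]
    positivity
  obtain ⟨j, rfl⟩ : ∃ j, i = j + 1 := ⟨i - 1, by omega⟩
  have h2 := h j (by omega)
  have h3 : (taylor c f.derivative).coeff j = (taylor c f).coeff (j + 1) * ((j + 1 : ℕ) : K) := by
    rw [taylor_coeff, taylor_coeff, mul_comm]
    have := congrArg (eval c) (hasseDeriv_comp (R := K) j 1 |> fun h => LinearMap.congr_fun h f)
    simp only [LinearMap.comp_apply, hasseDeriv_one, LinearMap.smul_apply, eval_smul] at this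
    rw [this, Nat.choose_symm_add, Nat.choose_one_right, nsmul_eq_mul]
  rw [h3, map_mul] at h2
  have h5 := hM (j + 1) hni (by omega)
  have hpM := hN.pow_pos M
  have hn0 := N.nonneg ((taylor c f).coeff (j + 1))
  rw [pow_succ, ← mul_assoc]
  refine mul_lt_mul_of_pos_right ?_ hρ
  have h6 : N p ^ M * (N ((taylor c f).coeff (j + 1)) * ρ ^ j) ≤
      N p ^ M * (N p * N (f.derivative.eval c)) := by
    calc N p ^ M * (N ((taylor c f).coeff (j + 1)) * ρ ^ j)
        ≤ N ((j + 1 : ℕ) : K) * (N ((taylor c f).coeff (j + 1)) * ρ ^ j) := by gcongr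
      _ = N ((taylor c f).coeff (j + 1)) * N ((j + 1 : ℕ) : K) * ρ ^ j := by ring
      _ ≤ _ := h2
      _ = _ := by ring
  refine (le_of_mul_le_mul_left h6 hpM).trans_lt ?_
  have := hN.p_lt_one
  nlinarith

include hN in
/-- Under the conclusion of `Dom.of_derivative`, the size of `f` at `c` is determined by the
distance of `c` to a root. -/
theorem eval_eq_of_isRoot {f : K[X]} {c α : K} (hα : f.IsRoot α) (hcα : α - c ≠ 0)
    (hc : f.derivative.eval c ≠ 0) (h : ∀ i, 2 ≤ i →
      N ((taylor c f).coeff i) * N (α - c) ^ i < N (f.derivative.eval c) * N (α - c)) :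
    N (f.eval c) = N (f.derivative.eval c) * N (α - c) := by
  have h1 := eval_add_eq_sum f c (α - c) (D := f.natDegree + 2) (by omega)
  rw [add_sub_cancel, hα.eq_zero, Finset.sum_range_succ', Finset.sum_range_succ', pow_zero,
    mul_one, taylor_coeff_zero, zero_add, pow_one, taylor_coeff_one] at h1
  have h2 : f.eval c - -(f.derivative.eval c * (α - c)) =
      -∑ k ∈ Finset.range f.natDegree, (taylor c f).coeff (k + 1 + 1) * (α - c) ^ (k + 1 + 1) := by
    linear_combination -h1
  have h3 := hN.eq_of_sub_lt (x := f.eval c) (y := -(f.derivative.eval c * (α - c))) (by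
    rw [h2, N.map_neg, N.map_neg, map_mul]
    refine hN.sum_lt _ _ (mul_pos (N.pos hc) (N.pos hcα)) fun i _ => ?_
    rw [map_mul, map_pow]
    exact h _ (by omega))
  rw [h3, N.map_neg, map_mul]

section
variable (hΓ : Maximal RespectsPow Γ)

include hN hN'

theorem coeff_map_mem (g : Γ[X]) (i : ℕ) : (g.map (fstHom Γ)).coeff i ∈ fstField hN hN' hΓ := by
  rw [coeff_map]
  exact ⟨_, rfl⟩

theorem exists_map_fstHom {f : K[X]} (hf : ∀ i, f.coeff i ∈ fstField hN hN' hΓ) (hm : f.Monic) :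
    ∃ F : Γ[X], F.Monic ∧ F.natDegree = f.natDegree ∧ F.map (fstHom Γ) = f := by
  have : f ∈ lifts (fstHom Γ) := by
    rw [lifts_iff_coeff_lifts]
    intro i
    obtain ⟨a, ha⟩ := hf i
    exact ⟨a, ha⟩
  obtain ⟨F, h1, h2, h3⟩ := lifts_and_natDegree_eq_and_monic this hm
  exact ⟨F, h3, h2, h1⟩

theorem mem_of_noBest {d : ℕ} (hA : RootClosed (fstField hN hN' hΓ) d) {F : Γ[X]} (hF : F.Monic)
    (hFd : F.natDegree = d + 1) {α : K} (hα : (F.map (fstHom Γ)).IsRoot α)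
    (hαA : α ∉ fstField hN hN' hΓ) : ¬ NoBest N (fstField hN hN' hΓ) α := by
  classical
  intro hbest
  have := hN.charZero
  refine hαA (mem_fstField_of_root hN hN' hΓ hF hα fun T hT => ?_)
  have hcoef := coeff_map_mem hN hN' hΓ
  obtain ⟨M₁, hM₁⟩ := hN.exists_isNthPow_congr_finset T (fun g => g.2) fun g hg => (hT g hg).1
  obtain ⟨M₂, hM₂⟩ := hN'.exists_isNthPow_congr_finset T (fun g => g.2) fun g hg => (hT g hg).1
  obtain ⟨M₃, hM₃⟩ := hN.exists_pow_le_natCast (d + 1)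
  set M := max M₁ M₂ with hM
  set f := F.map (fstHom Γ) with hf
  have hfd : f.natDegree = d + 1 := by rw [hf, hF.natDegree_map, hFd]
  have hf'd : f.derivative.natDegree = d := by
    rw [natDegree_derivative, hfd, Nat.add_sub_cancel]
  have hf'0 : f.derivative ≠ 0 := by
    intro h
    have := derivative_eq_zero.1 h
    omega
  have hdf : f.derivative = F.derivative.map (fstHom Γ) := by rw [hf, derivative_map]
  have hf'α : f.derivative.eval α ≠ 0 := fun h =>
    hαA (hA _ hf'0 hf'd.le (by rw [hdf]; exact hcoef _) α h)
  obtain ⟨c, hcA, hc', hcT⟩ : ∃ c ∈ fstField hN hN' hΓ,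
      Dom N p (M₃ + 1) f.derivative α (N (α - c)) ∧
      ∀ g ∈ T, Dom N p (M + 1) (g.1.map (fstHom Γ)) α (N (α - c)) := by
    choose! c₀ hc₀A hc₀ using fun (g : K[X]) (M : ℕ) (hg : g.natDegree ≤ d) hgA =>
      exists_dom hN hA hbest M (f := g) hg hgA
    let T' : Finset (K[X] × ℕ) := insert (f.derivative, M₃ + 1)
      (T.image fun g => (g.1.map (fstHom Γ), M + 1))
    have hT' : ∀ g ∈ T', g.1.natDegree ≤ d ∧ ∀ i, g.1.coeff i ∈ fstField hN hN' hΓ := by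
      intro g hg
      rcases Finset.mem_insert.1 hg with rfl | hg
      · exact ⟨hf'd.le, by rw [hdf]; exact hcoef _⟩
      · obtain ⟨g', hg', rfl⟩ := Finset.mem_image.1 hg
        refine ⟨natDegree_map_le.trans ?_, hcoef _⟩
        have := (hT g' hg').2
        omega
    obtain ⟨g₀, hg₀, hmin⟩ := Finset.exists_min_image T' (fun g => N (α - c₀ g.1 g.2))
      ⟨_, Finset.mem_insert_self _ _⟩
    have hdom : ∀ g ∈ T', Dom N p g.2 g.1 α (N (α - c₀ g₀.1 g₀.2)) := fun g hg =>
      hc₀ _ _ (hT' g hg).1 (hT' g hg).2 _ (hc₀A _ _ (hT' g₀ hg₀).1 (hT' g₀ hg₀).2) (hmin g hg)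
    exact ⟨_, hc₀A _ _ (hT' g₀ hg₀).1 (hT' g₀ hg₀).2, hdom _ (Finset.mem_insert_self _ _),
      fun g hg => hdom _ (Finset.mem_insert_of_mem (Finset.mem_image_of_mem _ hg))⟩
  obtain ⟨γ, rfl⟩ := (mem_fstField hN hN' hΓ).1 hcA
  have hne : α - (fstHom Γ) γ ≠ 0 := fun h0 => hαA (by rw [sub_eq_zero.1 h0]; exact hcA)
  have hcle : N ((fstHom Γ) γ - α) ≤ N (α - (fstHom Γ) γ) := by rw [← N.map_neg, neg_sub]
  obtain ⟨hD', hN'eq⟩ := Dom.recenter hN (by omega) hc' hcle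
  have hDT := fun g hg => (Dom.recenter hN (by omega) (hcT g hg) hcle).1
  have hq0 : f.derivative.eval ((fstHom Γ) γ) ≠ 0 := by
    rw [← N.ne_zero_iff, hN'eq, N.ne_zero_iff]
    exact hf'α
  have hlin := Dom.of_derivative hN hM₃ hfd.le (N.pos hne) hq0 hD'
  have hval := eval_eq_of_isRoot hN hα hne hq0 hlin
  have hevγ : ∀ g : Γ[X], (g.map (fstHom Γ)).eval ((fstHom Γ) γ) = (fstHom Γ) (g.eval γ) := fun g => eval_map_apply _ _
  have hevγ' : ∀ g : Γ[X], (g.map (sndHom Γ)).eval ((sndHom Γ) γ) = (sndHom Γ) (g.eval γ) := fun g => eval_map_apply _ _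
  have hty : ∀ (g : Γ[X]) i, (taylor ((fstHom Γ) γ) (g.map (fstHom Γ))).coeff i = (fstHom Γ) ((taylor γ g).coeff i) := by
    intro g i
    rw [← map_taylor, coeff_map]
  have hty' : ∀ (g : Γ[X]) i, (taylor ((sndHom Γ) γ) (g.map (sndHom Γ))).coeff i = (sndHom Γ) ((taylor γ g).coeff i) := by
    intro g i
    rw [← map_taylor, coeff_map]
  obtain ⟨ι, hι, hι'⟩ := exists_inv hN hN' hΓ (F.derivative.eval γ)
  rw [hdf, hevγ] at hq0
  rw [hdf, hf, hevγ, hevγ] at hval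
  set σ := F.eval γ * ι with hσ
  have hσN : N ((fstHom Γ) σ) = N (α - (fstHom Γ) γ) := by
    rw [hσ, map_mul, hι, map_mul, hval, map_inv₀]
    have := N.pos hq0
    field_simp
  have hq0' : (sndHom Γ) (F.derivative.eval γ) ≠ 0 := fun h =>
    hq0 ((fst_eq_zero_iff hN hN' hΓ.1 _).2 h)
  have hσ' : (sndHom Γ) (F.derivative.eval γ) * (sndHom Γ) σ = (sndHom Γ) (F.eval γ) := by
    rw [hσ, map_mul, hι', mul_comm, mul_assoc, inv_mul_cancel₀ hq0', mul_one]
  obtain ⟨α', hα', hαc', -⟩ := hN'.newton (F.map (sndHom Γ)) ((sndHom Γ) γ) ((sndHom Γ) σ)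
    (by rw [derivative_map, hevγ', hevγ', ← map_mul, hσ'])
    (by
      intro i hi
      have h1 := hlin i hi
      have h2 := lt_iff_lt hN hN' hΓ ((taylor γ F).coeff i * σ ^ i) (F.derivative.eval γ * σ)
      simp only [map_mul, map_pow] at h2
      rw [hdf, hevγ, hty, ← hσN, h2] at h1
      rwa [derivative_map, hevγ', hty'])
  refine ⟨α', hα', fun g hg => ?_⟩
  have hDg := hDT g hg
  have hDg' : Dom N' p (M + 1) (g.1.map (sndHom Γ)) ((sndHom Γ) γ) (N' ((sndHom Γ) σ)) := by
    intro i hi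
    have h1 := hDg i hi
    have h2 := le_iff_le hN hN' hΓ ((taylor γ g.1).coeff i * σ ^ i)
      ((p : Γ) ^ (M + 1) * g.1.eval γ)
    simp only [map_mul, map_pow, map_natCast] at h2
    rw [hevγ, hty, ← hσN, h2] at h1
    rwa [hevγ', hty']
  have e1 := hN.eval_sub_le hDg (le_refl (N (α - (fstHom Γ) γ)))
  have e2 := hN'.eval_sub_le hDg' hαc'
  rw [add_sub_cancel] at e1 e2
  rw [hM₁ (M + 1) (by omega) g hg _ _ e1, hM₂ (M + 1) (by omega) g hg _ _ e2, hevγ, hevγ']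
  exact hΓ.1.iff _ (hT g hg).1

theorem mem_of_pow_eq {d : ℕ} (hA : RootClosed (fstField hN hN' hΓ) d) {β : K}
    (hβ : β ^ (d + 1) ∈ fstField hN hN' hΓ) (hβ0 : β ≠ 0) :
    ∃ a ∈ fstField hN hN' hΓ, N β = N a := by
  classical
  by_contra! hne
  have hβA : β ∉ fstField hN hN' hΓ := fun h => hne _ h rfl
  obtain ⟨a, ha⟩ := (mem_fstField hN hN' hΓ).1 hβ
  have hcoef := coeff_map_mem hN hN' hΓ
  have hmon : (X ^ (d + 1) - C a : Γ[X]).Monic := monic_X_pow_sub_C a (by omega)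
  refine hβA (mem_fstField_of_root hN hN' hΓ hmon (by simp [ha]) fun T hT => ?_)
  obtain ⟨M₁, hM₁⟩ := hN.exists_isNthPow_congr_finset T (fun g => g.2) fun g hg => (hT g hg).1
  obtain ⟨M₂, hM₂⟩ := hN'.exists_isNthPow_congr_finset T (fun g => g.2) fun g hg => (hT g hg).1
  set M := max M₁ M₂ with hM
  set n := ∏ g ∈ T, g.2 with hn
  have hnpos : 0 < n := Finset.prod_pos fun g hg => (hT g hg).1
  obtain ⟨q, hq, w, hw⟩ := hN.rep n hnpos β hβ0
  have hq0 : (q : K) ≠ 0 := hN.natCast_ne_zero hq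
  have hq0' : (q : K') ≠ 0 := hN'.natCast_ne_zero hq
  have hw0 : w ≠ 0 := by
    rintro rfl
    rw [zero_pow hnpos.ne', mul_zero] at hw
    exact hβ0 hw
  obtain ⟨ι, hι, hι'⟩ := exists_inv hN hN' hΓ (q : Γ)
  have hpow : IsNthPow (n * (d + 1)) ((fstHom Γ) (a * ι ^ (d + 1))) := by
    refine ⟨w, ?_⟩
    rw [map_mul, map_pow, hι, ha, hw, map_natCast, mul_pow, pow_mul, inv_pow,
      mul_comm, ← mul_assoc, inv_mul_cancel₀ (pow_ne_zero _ hq0), one_mul]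
  obtain ⟨w', hw'⟩ := (hΓ.1.iff _ (by positivity)).1 hpow
  set β' := (q : K') * w' ^ n with hβ'
  have hβ'a : β' ^ (d + 1) = (sndHom Γ) a := by
    rw [map_mul, map_pow, hι', map_natCast] at hw'
    rw [hβ', mul_pow, ← pow_mul, hw', inv_pow, mul_comm, mul_assoc,
      inv_mul_cancel₀ (pow_ne_zero _ hq0'), mul_one]
  have hβ'0 : β' ≠ 0 := by
    intro h
    rw [h, zero_pow (by omega)] at hβ'a
    have h1 := (fst_eq_zero_iff hN hN' hΓ.1 a).2 hβ'a.symm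
    rw [ha] at h1
    exact pow_ne_zero _ hβ0 h1
  have hw'0 : w' ≠ 0 := by
    intro h
    rw [hβ', h, zero_pow hnpos.ne', mul_zero] at hβ'0
    exact hβ'0 rfl
  refine ⟨β', by simp [hβ'a], fun g hg => ?_⟩
  by_cases hg0 : g.1.map (fstHom Γ) = 0
  · have hg0' : g.1.map (sndHom Γ) = 0 := by
      ext i
      have h1 := congrArg (fun f => coeff f i) hg0
      simp only [coeff_map, coeff_zero] at h1 ⊢
      exact (fst_eq_zero_iff hN hN' hΓ.1 _).1 h1
    rw [hg0, hg0', eval_zero, eval_zero]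
    exact iff_of_true ⟨0, zero_pow (hT g hg).1.ne'⟩ ⟨0, zero_pow (hT g hg).1.ne'⟩
  have hgd : (g.1.map (fstHom Γ)).natDegree ≤ d := by
    have := (hT g hg).2
    rw [natDegree_X_pow_sub_C] at this
    exact natDegree_map_le.trans (by omega)
  obtain ⟨i₀, -, hi0, hdom⟩ := exists_dominant hN hβ0 (fun e he hed =>
    pow_ne_of_ne hN hA hβ0 hne e he hed) hg0 hgd (hcoef _)
  have hdom' : ∀ i, i ≠ i₀ → N' ((g.1.map (sndHom Γ)).coeff i * β' ^ i) ≤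
      N' p ^ M * N' ((g.1.map (sndHom Γ)).coeff i₀ * β' ^ i₀) := by
    intro i hi
    have h1 := pow_le_pow_left₀ (N.nonneg _) (hdom i hi M).le (d + 1)
    rw [← pow_le_pow_iff_left₀ (N'.nonneg _)
      (mul_nonneg (hN'.pow_pos M).le (N'.nonneg _)) (Nat.succ_ne_zero d)]
    have h2 := le_iff_le hN hN' hΓ (g.1.coeff i ^ (d + 1) * a ^ i)
      (((p : Γ) ^ M) ^ (d + 1) * (g.1.coeff i₀ ^ (d + 1) * a ^ i₀))
    simp only [map_mul, map_pow, map_natCast, ha, hβ'a.symm] at h2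
    simp only [coeff_map, map_mul, map_pow, mul_pow, pow_right_comm _ _ (d + 1)] at h1 h2 ⊢
    exact h2.1 h1
  have e1 := hM₁ M (by omega) g hg _ _ (eval_sub_dominant_le hN fun j hj => (hdom j hj M).le)
  have e2 := hM₂ M (by omega) g hg _ _ (eval_sub_dominant_le hN' hdom')
  rw [e1, e2]
  obtain ⟨k, hk⟩ := Finset.dvd_prod_of_mem (fun g : Γ[X] × ℕ => g.2) hg
  rw [← hn] at hk
  have e3 : (g.1.map (fstHom Γ)).coeff i₀ * β ^ i₀ =
      (fstHom Γ) (g.1.coeff i₀ * (q : Γ) ^ i₀) * (w ^ (k * i₀)) ^ g.2 := by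
    rw [coeff_map, hw, hk, map_mul, map_pow, map_natCast]
    ring
  have e4 : (g.1.map (sndHom Γ)).coeff i₀ * β' ^ i₀ =
      (sndHom Γ) (g.1.coeff i₀ * (q : Γ) ^ i₀) * (w' ^ (k * i₀)) ^ g.2 := by
    rw [coeff_map, hβ', hk, map_mul, map_pow, map_natCast]
    ring
  rw [e3, e4, isNthPow_mul_pow_iff (pow_ne_zero _ hw0), isNthPow_mul_pow_iff (pow_ne_zero _ hw'0)]
  exact hΓ.1.iff _ (hT g hg).1

/-- The domain of a maximal correspondence is relatively algebraically closed. -/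
theorem rootClosed_fstField (d : ℕ) : RootClosed (fstField hN hN' hΓ) d := by
  induction d with
  | zero =>
    intro f hf0 hfd _ x hx
    rw [eq_C_of_natDegree_le_zero hfd] at hf0 hx
    rw [IsRoot, eval_C] at hx
    rw [hx, C_0] at hf0
    exact absurd rfl hf0
  | succ d ih =>
    intro f₀ hf0 hfd₀ hfA₀ α hα₀
    by_contra hαA
    have hlc : f₀.leadingCoeff ≠ 0 := leadingCoeff_ne_zero.2 hf0
    obtain ⟨F, hF, hFd, hFf⟩ := exists_map_fstHom hN hN' hΓ
      (f := f₀ * C f₀.leadingCoeff⁻¹) (fun i => by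
        rw [coeff_mul_C]
        exact mul_mem (hfA₀ i) (inv_mem (hfA₀ _))) (monic_mul_leadingCoeff_inv hf0)
    have hfd : F.natDegree ≤ d + 1 := by
      rw [hFd, natDegree_mul_C (inv_ne_zero hlc)]
      exact hfd₀
    have hα : (F.map (fstHom Γ)).IsRoot α := by
      rw [hFf, IsRoot, eval_mul, hα₀.eq_zero, zero_mul]
    have hcoef := coeff_map_mem hN hN' hΓ F
    rcases hfd.lt_or_eq with hlt | heq
    · exact hαA (ih _ (hF.map _).ne_zero (natDegree_map_le.trans (by omega)) hcoef α hα)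
    have hbest := mem_of_noBest hN hN' hΓ ih hF heq hα hαA
    simp only [NoBest, not_forall, not_exists, not_and, not_lt] at hbest
    obtain ⟨c, hc, hbest⟩ := hbest
    have hne := ne_of_best hN hαA hc hbest
    have hx0 : α - c ≠ 0 := fun h0 => hαA (by rw [sub_eq_zero.1 h0]; exact hc)
    set f := F.map (fstHom Γ) with hf
    have htay := taylor_coeff_mem hcoef hc
    obtain ⟨a, haA, ha⟩ : ∃ a ∈ fstField hN hN' hΓ, N (α - c) ^ (d + 1) = N a := by
      by_contra! hcon
      obtain ⟨i₀, -, hi0, hdom⟩ := exists_dominant hN (d := d + 1) (f := taylor c f) hx0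
        (fun e he hed => by
          rcases hed.lt_or_eq with hlt | rfl
          · exact pow_ne_of_ne hN ih hx0 hne e he (by omega)
          · exact hcon)
        (by rw [Ne, taylor_eq_zero]; exact (hF.map _).ne_zero)
        (by rw [natDegree_taylor]; exact natDegree_map_le.trans hfd) htay
      have h1 := eval_sub_dominant_le hN (M := 1) fun j hj => (hdom j hj 1).le
      rw [taylor_eval, sub_add_cancel, hα.eq_zero, zero_sub, N.map_neg, pow_one] at h1
      have h2 := N.pos (mul_ne_zero hi0 (pow_ne_zero i₀ hx0))
      have := hN.p_lt_one
      nlinarith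
    obtain ⟨β, hβ, hβA⟩ := hN.exists_pow_mem haA (by
      rintro rfl
      rw [map_zero] at ha
      exact hx0 (N.eq_zero.1 (pow_eq_zero_iff (by omega) |>.1 ha))) (by omega) ha
    obtain ⟨b, hb, hβb⟩ := mem_of_pow_eq hN hN' hΓ ih hβA (by
      rw [← N.ne_zero_iff, hβ, N.ne_zero_iff]
      exact hx0)
    exact hne b hb (hβ ▸ hβb)

end

end Extension
end PadicLike

namespace Padic

variable {p : ℕ} [Fact p.Prime]

theorem exists_natCast_near (M : ℕ) (u : ℚ_[p]) (hu : ‖u‖ ≤ 1) :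
    ∃ k < p ^ M, ‖u - (k : ℕ)‖ ≤ ‖(p : ℚ_[p])‖ ^ M := by
  obtain ⟨x, rfl⟩ : ∃ x : ℤ_[p], (x : ℚ_[p]) = u := ⟨⟨u, hu⟩, rfl⟩
  refine ⟨x.appr M, x.appr_lt _, ?_⟩
  have h := PadicInt.appr_spec M x
  rw [← PadicInt.norm_le_pow_iff_mem_span_pow, PadicInt.norm_def, PadicInt.coe_sub,
    PadicInt.coe_natCast, zpow_neg, zpow_natCast] at h
  rwa [Padic.norm_p, inv_pow]

theorem norm_le_norm_p (z : ℚ_[p]) (hz : ‖z‖ < 1) : ‖z‖ ≤ ‖(p : ℚ_[p])‖ := by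
  have := (Padic.norm_le_pow_iff_norm_lt_pow_add_one z (-1)).2 (by simpa using hz)
  rwa [Padic.norm_p, ← zpow_neg_one]

theorem isNthPow_of_near {n : ℕ} (hn : 0 < n) :
    ∃ M : ℕ, ∀ u : ℚ_[p], ‖u - 1‖ ≤ ‖(p : ℚ_[p])‖ ^ M → IsNthPow n u := by
  have hd : HasStrictDerivAt (fun z : ℚ_[p] => z ^ n) ((n : ℚ_[p]) * 1 ^ (n - 1)) 1 :=
    hasStrictDerivAt_pow n 1
  have hne : (n : ℚ_[p]) * 1 ^ (n - 1) ≠ 0 := by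
    simpa using hn.ne'
  have h := hd.map_nhds_eq hne
  rw [one_pow] at h
  have h2 : Set.range (fun z : ℚ_[p] => z ^ n) ∈ 𝓝 (1 : ℚ_[p]) := by
    rw [← h]; exact Filter.range_mem_map
  obtain ⟨r, hr, hr'⟩ := Metric.mem_nhds_iff.1 h2
  obtain ⟨M, hM⟩ := exists_pow_lt_of_lt_one hr (Padic.norm_p_lt_one (p := p))
  refine ⟨M, fun u hu => ?_⟩
  obtain ⟨y, hy⟩ := hr' (a := u) (by rw [Metric.mem_ball, dist_eq_norm]; exact hu.trans_lt hM)
  exact ⟨y, hy⟩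

theorem exists_eq_natCast_mul_pow {n : ℕ} (hn : 0 < n) :
    ∃ B : ℕ, ∀ z : ℚ_[p], z ≠ 0 → ∃ q < B, q ≠ 0 ∧ ∃ w, z = (q : ℕ) * w ^ n := by
  obtain ⟨M, hM⟩ := isNthPow_of_near (p := p) hn
  have hp : p.Prime := Fact.out
  have hp0 : (p : ℚ_[p]) ≠ 0 := by exact_mod_cast hp.ne_zero
  refine ⟨p ^ n * p ^ (M + 1), fun z hz => ?_⟩
  set u := z * (p : ℚ_[p]) ^ (-z.valuation) with hu
  have hu1 : ‖u‖ = 1 := by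
    rw [hu, norm_mul, Padic.norm_eq_zpow_neg_valuation hz, Padic.norm_p_zpow, neg_neg,
      ← zpow_add₀ (by exact_mod_cast hp.ne_zero)]
    simp
  obtain ⟨q, hq, hqu⟩ := exists_natCast_near (M + 1) u hu1.le
  have hlt : ‖u - (q : ℕ)‖ < 1 := by
    refine hqu.trans_lt (pow_lt_one₀ (norm_nonneg _) Padic.norm_p_lt_one (by omega))
  have hq1 : ‖(q : ℚ_[p])‖ = 1 := by
    have h : (q : ℚ_[p]) = u + -(u - q) := by ring
    rw [h, Padic.add_eq_max_of_ne (by rw [hu1, norm_neg]; exact hlt.ne'), norm_neg, hu1,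
      max_eq_left hlt.le]
  have hq0 : (q : ℚ_[p]) ≠ 0 := by
    rw [← norm_ne_zero_iff, hq1]; exact one_ne_zero
  obtain ⟨w, hw⟩ := hM (u / q) (by
    rw [div_sub_one hq0, norm_div, hq1, div_one]
    exact hqu.trans (pow_le_pow_of_le_one (norm_nonneg _) Padic.norm_p_lt_one.le (by omega)))
  have hn' : (0 : ℤ) < n := by exact_mod_cast hn
  have hr0 := Int.emod_nonneg z.valuation hn'.ne'
  have hr1 := Int.emod_lt_of_pos z.valuation hn'
  refine ⟨p ^ (z.valuation % n).toNat * q, ?_, ?_, (p : ℚ_[p]) ^ (z.valuation / n) * w, ?_⟩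
  · exact Nat.mul_lt_mul_of_le_of_lt (Nat.pow_le_pow_right hp.pos (by omega)) hq
      (Nat.pos_of_ne_zero (pow_ne_zero _ hp.ne_zero))
  · refine mul_ne_zero (pow_ne_zero _ hp.ne_zero) ?_
    exact_mod_cast hq0
  · rw [mul_pow, hw, Nat.cast_mul, Nat.cast_pow, ← zpow_natCast, ← zpow_natCast, ← zpow_mul,
      Int.toNat_of_nonneg hr0]
    have h : (p : ℚ_[p]) ^ (z.valuation % n) * (p : ℚ_[p]) ^ (z.valuation / n * n)
      = (p : ℚ_[p]) ^ z.valuation := by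
      rw [← zpow_add₀ hp0]
      congr 1
      rw [mul_comm]
      exact Int.emod_add_mul_ediv _ _
    calc z = (p : ℚ_[p]) ^ z.valuation * u := by
          rw [hu, mul_comm z, ← mul_assoc, ← zpow_add₀ hp0]; simp
      _ = _ := by rw [← h]; field_simp

theorem norm_le_one_iff_isNthPow (z : ℚ_[p]) :
    ‖z‖ ≤ 1 ↔ IsNthPow 2 (1 + (p : ℚ_[p]) ^ 3 * z ^ 4) := by
  have hp : p.Prime := Fact.out
  have hp1 : (1 : ℝ) < p := by exact_mod_cast hp.one_lt
  constructor
  · intro hz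
    set x : ℤ_[p] := ⟨z, hz⟩ with hx
    set w : ℤ_[p] := 1 + p ^ 3 * x ^ 4 with hw
    set F : ℤ_[p][X] := X ^ 2 - C w with hF
    have h1 : F.aeval (1 : ℤ_[p]) = - (p ^ 3 * x ^ 4) := by simp [hF, hw]
    have h2 : F.derivative.aeval (1 : ℤ_[p]) = 2 := by
      simp only [hF, derivative_sub, derivative_X_pow, derivative_C]; simp
    have h3 : (p : ℝ)⁻¹ ≤ ‖(2 : ℤ_[p])‖ := by
      by_cases h : p = 2
      · subst h
        exact_mod_cast (PadicInt.norm_p (p := 2)).ge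
      · have : ‖((2 : ℕ) : ℤ_[p])‖ = 1 := by
          rw [PadicInt.norm_def, PadicInt.coe_natCast, Padic.norm_natCast_eq_one_iff]
          exact (Nat.coprime_primes hp Nat.prime_two).2 h
        push_cast at this
        rw [this]
        exact inv_le_one_of_one_le₀ hp1.le
    obtain ⟨y, hy, _⟩ := hensels_lemma (F := F) (a := 1) (by
      rw [h1, h2, norm_neg, norm_mul, norm_pow, norm_pow, PadicInt.norm_p]
      calc (p : ℝ)⁻¹ ^ 3 * ‖x‖ ^ 4 ≤ (p : ℝ)⁻¹ ^ 3 * 1 := by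
            gcongr; exact pow_le_one₀ (norm_nonneg _) (PadicInt.norm_le_one x)
        _ < (p : ℝ)⁻¹ ^ 2 := by
            rw [mul_one]
            exact pow_lt_pow_right_of_lt_one₀ (by positivity) (inv_lt_one_of_one_lt₀ hp1)
              (by norm_num)
        _ ≤ _ := by gcongr)
    refine ⟨y, ?_⟩
    have h4 : y ^ 2 = 1 + p ^ 3 * x ^ 4 := by
      simpa [hF, sub_eq_zero] using hy
    have h5 := congrArg (fun t : ℤ_[p] => (t : ℚ_[p])) h4
    simp only [PadicInt.coe_add, PadicInt.coe_mul, PadicInt.coe_pow, PadicInt.coe_one,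
      PadicInt.coe_natCast] at h5
    exact h5
  · rintro ⟨y, hy⟩
    by_contra! hz
    have hz0 : z ≠ 0 := by rintro rfl; simp at hz; linarith
    have hpn : (p : ℚ_[p]) ≠ 0 := by exact_mod_cast hp.ne_zero
    have hv : z.valuation < 0 := by
      by_contra! h
      exact absurd (Padic.norm_le_one_iff_val_nonneg z |>.2 h) (by linarith)
    have hn : ‖(p : ℚ_[p]) ^ 3 * z ^ 4‖ = (p : ℝ) ^ (-(3 + 4 * z.valuation)) := by
      rw [Padic.norm_eq_zpow_neg_valuation (by positivity), Padic.valuation_mul (by positivity)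
        (by positivity), Padic.valuation_pow, Padic.valuation_pow, Padic.valuation_p]
      simp
    have h1 : ‖1 + (p : ℚ_[p]) ^ 3 * z ^ 4‖ = (p : ℝ) ^ (-(3 + 4 * z.valuation)) := by
      have hgt : 1 < (p : ℝ) ^ (-(3 + 4 * z.valuation)) := one_lt_zpow₀ hp1 (by omega)
      rw [Padic.add_eq_max_of_ne, hn, norm_one, max_eq_right hgt.le]
      rw [hn, norm_one]; exact hgt.ne
    have hy0 : y ≠ 0 := by
      rintro rfl
      rw [← hy] at h1
      simp at h1
      exact absurd h1.symm (zpow_ne_zero _ (by positivity))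
    rw [← hy, norm_pow, Padic.norm_eq_zpow_neg_valuation hy0, ← zpow_natCast, ← zpow_mul] at h1
    have := zpow_right_injective₀ (by positivity) hp1.ne' h1
    push_cast at this
    omega

theorem exists_root_of_norm_lt_one (d : ℕ) (b : ℕ → ℚ_[p]) (h0 : ‖b 0‖ ≤ 1)
    (hb : ∀ i ∈ Finset.Ico 2 d, ‖b i‖ < 1) :
    ∃ z, ‖z‖ ≤ 1 ∧ b 0 + z + ∑ i ∈ Finset.Ico 2 d, b i * z ^ i = 0 := by
  set c : ℕ → ℤ_[p] := fun i => if h : ‖b i‖ ≤ 1 then ⟨b i, h⟩ else 0 with hc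
  have hc0 : (c 0 : ℚ_[p]) = b 0 := by simp [hc, h0]
  have hci : ∀ i ∈ Finset.Ico 2 d, (c i : ℚ_[p]) = b i := fun i hi => by
    simp [hc, (hb i hi).le]
  have hci' : ∀ i ∈ Finset.Ico 2 d, ‖c i‖ < 1 := fun i hi => by
    rw [PadicInt.norm_def, hci i hi]; exact hb i hi
  set F : ℤ_[p][X] := C (c 0) + X + ∑ i ∈ Finset.Ico 2 d, C (c i) * X ^ i with hF
  have hsum : ∀ g : ℕ → ℤ_[p], ‖∑ i ∈ Finset.Ico 2 d, c i * g i‖ < 1 := by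
    intro g
    rw [← PadicInt.mem_nonunits, ← IsLocalRing.mem_maximalIdeal]
    refine Ideal.sum_mem _ fun i hi => Ideal.mul_mem_right _ _ ?_
    rw [IsLocalRing.mem_maximalIdeal, PadicInt.mem_nonunits]
    exact hci' i hi
  have h1 : ‖F.aeval (-c 0)‖ < 1 := by
    have : F.aeval (-c 0) = ∑ i ∈ Finset.Ico 2 d, c i * (-c 0) ^ i := by
      simp [hF, eval_finsetSum]
    rw [this]; exact hsum _
  have h2 : ‖F.derivative.aeval (-c 0)‖ = 1 := by
    have : F.derivative.aeval (-c 0)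
        = 1 + ∑ i ∈ Finset.Ico 2 d, c i * (i * (-c 0) ^ (i - 1)) := by
      simp [hF, eval_finsetSum, derivative_X_pow]
    rw [this, PadicInt.norm_add_eq_max_of_ne, norm_one, max_eq_left (hsum _).le]
    rw [norm_one]
    exact (hsum _).ne'
  obtain ⟨z, hz, _⟩ := hensels_lemma (F := F) (a := -c 0) (by rw [h2]; simpa using h1)
  refine ⟨z, PadicInt.norm_le_one z, ?_⟩
  have h3 : c 0 + z + ∑ i ∈ Finset.Ico 2 d, c i * z ^ i = 0 := by
    simpa [hF, eval_finsetSum] using hz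
  have h4 := congrArg (fun t : ℤ_[p] => (t : ℚ_[p])) h3
  simp only [PadicInt.coe_add, PadicInt.coe_sum, PadicInt.coe_mul, PadicInt.coe_pow,
    PadicInt.coe_zero, hc0] at h4
  rw [← h4]
  congr 1
  exact Finset.sum_congr rfl fun i hi => by rw [hci i hi]

end Padic

section Germ

variable {T : Type*} (U : Ultrafilter T)

theorem isNthPow_coe_iff {K : Type*} [Monoid K] {U : Ultrafilter T} {n : ℕ} {f : T → K} :
    IsNthPow n (f : Germ (U : Filter T) K) ↔ ∀ᶠ t in U, IsNthPow n (f t) := by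
  constructor
  · rintro ⟨y, hy⟩
    induction y using Germ.inductionOn with | _ y
    rw [← Germ.coe_pow] at hy
    filter_upwards [Germ.coe_eq.1 hy] with t ht
    exact ⟨y t, ht⟩
  · intro h
    choose! y hy using fun t (h : IsNthPow n (f t)) => h
    refine ⟨(y : Germ (U : Filter T) K), ?_⟩
    rw [← Germ.coe_pow]
    exact Germ.coe_eq.2 (h.mono hy)

variable {p : ℕ} [Fact p.Prime]

/-- The absolute value on an ultrapower of `ℚ_[p]`. -/
noncomputable def germNorm : AbsoluteValue (Germ (U : Filter T) ℚ_[p]) (Germ (U : Filter T) ℝ) where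
  toFun := Germ.map norm
  map_mul' x y := by
    induction x, y using Germ.inductionOn₂ with | _ x y
    exact Germ.coe_eq.2 (.of_forall fun t => norm_mul _ _)
  nonneg' x := by
    induction x using Germ.inductionOn with | _ x
    exact Germ.coe_le.2 (.of_forall fun t => norm_nonneg _)
  eq_zero' x := by
    induction x using Germ.inductionOn with | _ x
    refine Germ.coe_eq.trans (Iff.trans ?_ Germ.coe_eq.symm)
    exact Filter.eventually_congr (.of_forall fun t => norm_eq_zero)
  add_le' x y := by
    induction x, y using Germ.inductionOn₂ with | _ x y
    exact Germ.coe_le.2 (.of_forall fun t => norm_add_le _ _)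

@[simp] theorem germNorm_coe (f : T → ℚ_[p]) : germNorm U (f : Germ (U : Filter T) ℚ_[p])
    = ((fun t => ‖f t‖ : T → ℝ) : Germ (U : Filter T) ℝ) := rfl

theorem germ_natCast (k : ℕ) : (k : Germ (U : Filter T) ℚ_[p])
    = ((fun _ => (k : ℚ_[p]) : T → ℚ_[p]) : Germ (U : Filter T) ℚ_[p]) := rfl

theorem padicLike_germNorm : PadicLike p (germNorm (p := p) U) where
  add_le_max x y := by
    induction x, y using Germ.inductionOn₂ with | _ x y
    rw [Germ.max_def]
    exact Germ.coe_le.2 (.of_forall fun t => IsUltrametricDist.norm_add_le_max _ _)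
  p_pos := by
    rw [germ_natCast, germNorm_coe]
    exact Germ.coe_pos.2 (.of_forall fun t => norm_pos_iff.2 (NeZero.ne _))
  p_lt_one := Germ.coe_lt.2 (.of_forall fun t => Padic.norm_p_lt_one)
  natCast_ge k hk := by
    obtain ⟨M, hM⟩ := exists_pow_lt_of_lt_one (norm_pos_iff.2 (Nat.cast_ne_zero (R := ℚ_[p]).2 hk))
      (Padic.norm_p_lt_one (p := p))
    exact ⟨M, Germ.coe_le.2 (.of_forall fun t => hM.le)⟩
  residue M u hu := by
    induction u using Germ.inductionOn with | _ u
    have h : ∀ᶠ t in U, ∃ k ∈ Set.Iio (p ^ M), ‖u t - (k : ℕ)‖ ≤ ‖(p : ℚ_[p])‖ ^ M :=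
      (Germ.coe_le.1 hu).mono fun t ht => Padic.exists_natCast_near M (u t) ht
    obtain ⟨k, -, hk⟩ := (Ultrafilter.eventually_exists_mem_iff (Set.finite_Iio _)).1 h
    exact ⟨k, Germ.coe_le.2 hk⟩
  discrete z hz := by
    induction z using Germ.inductionOn with | _ z
    exact Germ.coe_le.2 ((Germ.coe_lt.1 hz).mono fun t ht => Padic.norm_le_norm_p _ ht)
  rep n hn z hz := by
    induction z using Germ.inductionOn with | _ z
    obtain ⟨B, hB⟩ := Padic.exists_eq_natCast_mul_pow (p := p) hn
    have hz' : ∀ᶠ t in U, z t ≠ 0 :=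
      Ultrafilter.eventually_not.2 fun h => hz (Germ.coe_eq.2 h)
    obtain ⟨q, -, hq⟩ := (Ultrafilter.eventually_exists_mem_iff (Set.finite_Iio B)).1
      (hz'.mono fun t ht => hB _ ht)
    choose! w hw using fun t (h : q ≠ 0 ∧ ∃ w, z t = (q : ℕ) * w ^ n) => h.2
    obtain ⟨t, ht⟩ := hq.exists
    exact ⟨q, ht.1, (w : Germ (U : Filter T) ℚ_[p]), Germ.coe_eq.2 (hq.mono hw)⟩
  isNthPow_of_near n hn := by
    obtain ⟨M, hM⟩ := Padic.isNthPow_of_near (p := p) hn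
    refine ⟨M, fun u hu => ?_⟩
    induction u using Germ.inductionOn with | _ u
    exact isNthPow_coe_iff.2 ((Germ.coe_le.1 hu).mono fun t ht => hM _ ht)
  le_one_iff z := by
    induction z using Germ.inductionOn with | _ z
    refine Germ.coe_le.trans (Iff.trans ?_ (isNthPow_coe_iff
      (f := fun t => 1 + (p : ℚ_[p]) ^ 3 * z t ^ 4)).symm)
    exact Filter.eventually_congr (.of_forall fun t => Padic.norm_le_one_iff_isNthPow _)
  hensel d b hb0 hb := by
    have h : ∀ i, ∃ f : T → ℚ_[p], (f : Germ (U : Filter T) ℚ_[p]) = b i := fun i =>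
      Quotient.exists_rep (b i)
    choose f hf using h
    obtain rfl : (fun i => (f i : Germ (U : Filter T) ℚ_[p])) = b := funext hf
    have h1 : ∀ᶠ t in U, ∀ i ∈ Finset.Ico 2 d, ‖f i t‖ < 1 := by
      rw [Filter.eventually_all_finset]
      exact fun i hi => Germ.coe_lt.1 (hb i (Finset.mem_Ico.1 hi).1)
    have h2 := ((Germ.coe_le.1 hb0).and h1).mono fun t ht =>
      Padic.exists_root_of_norm_lt_one d (fun i => f i t) ht.1 ht.2
    choose! z hz using fun t (h : ∃ z, ‖z‖ ≤ 1 ∧ f 0 t + z + ∑ i ∈ Finset.Ico 2 d, f i t * z ^ i = 0)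
      => h
    refine ⟨(z : Germ (U : Filter T) ℚ_[p]), Germ.coe_le.2 (h2.mono fun t ht => (hz t ht).1), ?_⟩
    have h3 : ∑ i ∈ Finset.Ico 2 d, (f i : Germ (U : Filter T) ℚ_[p]) * (z : Germ _ _) ^ i
        = ((∑ i ∈ Finset.Ico 2 d, f i * z ^ i : T → ℚ_[p]) : Germ (U : Filter T) ℚ_[p]) :=
      (map_sum (Germ.coeRingHom (U : Filter T)) (fun i => f i * z ^ i) _).symm
    rw [h3]
    refine Germ.coe_eq.2 (h2.mono fun t ht => ?_)
    simpa using (hz t ht).2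

end Germ

/-- Evaluation of integer polynomials in several variables. -/
noncomputable def intEval {ι K : Type*} [CommRing K] (x : ι → K) : MvPolynomial ι ℤ →+* K :=
  MvPolynomial.eval₂Hom (Int.castRingHom K) x

theorem map_intEval {ι K L : Type*} [CommRing K] [CommRing L] (φ : K →+* L) (x : ι → K)
    (P : MvPolynomial ι ℤ) : φ (intEval x P) = intEval (fun i => φ (x i)) P := by
  simp only [intEval, MvPolynomial.coe_eval₂Hom]
  rw [MvPolynomial.eval₂_comp_left, RingHom.ext_int (φ.comp _) (Int.castRingHom L)]
  rfl

theorem intEval_rename {ι κ K : Type*} [CommRing K] (e : ι → κ) (x : κ → K)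
    (P : MvPolynomial ι ℤ) : intEval x (MvPolynomial.rename e P) = intEval (x ∘ e) P := by
  simp [intEval, MvPolynomial.eval₂_rename]

theorem intEval_germ {ι T K : Type*} [CommRing K] (U : Ultrafilter T) (x : ι → T → K)
    (P : MvPolynomial ι ℤ) :
    intEval (fun i => (x i : Germ (U : Filter T) K)) P
      = ((fun t => intEval (fun i => x i t) P : T → K) : Germ (U : Filter T) K) := by
  have h := map_intEval (Germ.coeRingHom (U : Filter T)) x P
  rw [Germ.coe_coeRingHom] at h
  rw [← h]
  congr 1
  funext t
  exact map_intEval (Pi.evalRingHom (fun _ : T => K) t) x P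

namespace PadicLike

section

variable {p : ℕ} {K R K' R' : Type*} [Field K] [Field R] [LinearOrder R] [IsStrictOrderedRing R]
  [Field K'] [Field R'] [LinearOrder R'] [IsStrictOrderedRing R']
  {N : AbsoluteValue K R} {N' : AbsoluteValue K' R'} {Γ : Subring (K × K')}

/-- Every finite set of power conditions over the domain of a maximal correspondence that holds for
some element of `K` already holds for an element of the domain. -/
theorem exists_isNthPow_iff_of_maximal (hN : PadicLike p N) (hN' : PadicLike p N')
    (hΓ : Maximal RespectsPow Γ) (α : K) (T : Finset (Γ[X] × ℕ)) (hT : ∀ g ∈ T, 0 < g.2) :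
    ∃ c : Γ, ∀ g ∈ T, (IsNthPow g.2 ((g.1.map (fstHom Γ)).eval α) ↔
      IsNthPow g.2 (fstHom Γ (g.1.eval c))) ∧
      (IsNthPow g.2 ((g.1.map (fstHom Γ)).eval α) ↔ IsNthPow g.2 (sndHom Γ (g.1.eval c))) := by
  classical
  obtain ⟨c, hc, h⟩ := hN.exists_mem_isNthPow_iff (A := fstField hN hN' hΓ)
    (rootClosed_fstField hN hN' hΓ) α (T.image fun g => (g.1.map (fstHom Γ), g.2)) (by
      intro g hg
      obtain ⟨g', hg', rfl⟩ := Finset.mem_image.1 hg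
      exact ⟨hT g' hg', fun i => coeff_map_mem hN hN' hΓ _ _⟩)
  obtain ⟨c, rfl⟩ := (mem_fstField hN hN' hΓ).1 hc
  refine ⟨c, fun g hg => ?_⟩
  have h1 := h _ (Finset.mem_image_of_mem _ hg)
  rw [eval_map_apply] at h1
  exact ⟨h1.symm, h1.symm.trans (hΓ.prop.iff _ (hT g hg))⟩

/-- One-variable extension of tuples satisfying the same power conditions. -/
theorem exists_extension {ι : Type*} (hN : PadicLike p N) (hN' : PadicLike p N')
    (x : ι → K) (x' : ι → K') (hx : ∀ (P : MvPolynomial ι ℤ) (n : ℕ), 0 < n →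
      (IsNthPow n (intEval x P) ↔ IsNthPow n (intEval x' P)))
    (t : K) (Λ : Finset (MvPolynomial (Option ι) ℤ × ℕ)) (hΛ : ∀ g ∈ Λ, 0 < g.2) :
    ∃ t' : K', ∀ g ∈ Λ, (IsNthPow g.2 (intEval (fun o => o.elim t x) g.1) ↔
      IsNthPow g.2 (intEval (fun o => o.elim t' x') g.1)) := by
  classical
  obtain ⟨Γ, hΓ₀, hΓ⟩ := exists_maximal_respectsPow
    (Γ₀ := (intEval (fun i => (x i, x' i))).range) (by
      rintro _ ⟨P, rfl⟩ n hn
      have h1 := map_intEval (RingHom.fst K K') (fun i => (x i, x' i)) P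
      have h2 := map_intEval (RingHom.snd K K') (fun i => (x i, x' i)) P
      simp only [RingHom.coe_fst, RingHom.coe_snd] at h1 h2
      rw [h1, h2]
      exact hx P n hn)
  have hmem : ∀ i, (x i, x' i) ∈ Γ := fun i => hΓ₀ ⟨MvPolynomial.X i, by simp [intEval]⟩
  set ξ : ι → Γ := fun i => ⟨(x i, x' i), hmem i⟩ with hξ
  set G : MvPolynomial (Option ι) ℤ →+* Γ[X] := intEval fun o => o.elim X fun i => C (ξ i) with hG
  obtain ⟨c, hc⟩ := exists_isNthPow_iff_of_maximal hN hN' hΓ t (Λ.image fun g => (G g.1, g.2)) (by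
    intro g hg
    obtain ⟨g', hg', rfl⟩ := Finset.mem_image.1 hg
    exact hΛ g' hg')
  refine ⟨sndHom Γ c, fun g hg => ?_⟩
  have h1 := (hc _ (Finset.mem_image_of_mem _ hg)).2
  have h2 : ((G g.1).map (fstHom Γ)).eval t = intEval (fun o => o.elim t x) g.1 := by
    have := map_intEval ((evalRingHom t).comp (mapRingHom (fstHom Γ)))
      (fun o => o.elim X fun i => C (ξ i)) g.1
    simp only [RingHom.comp_apply, coe_mapRingHom, coe_evalRingHom] at this
    rw [hG, this]
    congr 2
    funext o
    cases o <;> simp [hξ, fstHom]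
  have h3 : sndHom Γ ((G g.1).eval c) = intEval (fun o => o.elim (sndHom Γ c) x') g.1 := by
    have := map_intEval ((sndHom Γ).comp (evalRingHom c))
      (fun o => o.elim X fun i => C (ξ i)) g.1
    simp only [RingHom.comp_apply, coe_evalRingHom] at this
    rw [hG, this]
    congr 2
    funext o
    cases o <;> simp [hξ, sndHom]
  rwa [h2, h3] at h1

end

end PadicLike

section Elimination

/-- A set of tuples that is a Boolean combination of power conditions on polynomials. -/
def IsPowSet {ι K : Type*} [CommRing K] (S : Set (ι → K)) : Prop :=
  ∃ Λ : Finset (MvPolynomial ι ℤ × ℕ), (∀ g ∈ Λ, 0 < g.2) ∧ ∀ x y : ι → K,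
    (∀ g ∈ Λ, IsNthPow g.2 (intEval x g.1) ↔ IsNthPow g.2 (intEval y g.1)) → (x ∈ S ↔ y ∈ S)

theorem IsPowSet.compl {ι K : Type*} [CommRing K] {S : Set (ι → K)} (hS : IsPowSet S) :
    IsPowSet Sᶜ := by
  obtain ⟨Λ, hΛ, h⟩ := hS
  exact ⟨Λ, hΛ, fun x y hxy => not_congr (h x y hxy)⟩

theorem IsPowSet.union {ι K : Type*} [CommRing K] {S S' : Set (ι → K)} (hS : IsPowSet S)
    (hS' : IsPowSet S') : IsPowSet (S ∪ S') := by
  classical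
  obtain ⟨Λ, hΛ, h⟩ := hS
  obtain ⟨Λ', hΛ', h'⟩ := hS'
  refine ⟨Λ ∪ Λ', fun g hg => (Finset.mem_union.1 hg).elim (hΛ g) (hΛ' g), fun x y hxy => ?_⟩
  exact or_congr (h x y fun g hg => hxy g (Finset.mem_union_left _ hg))
    (h' x y fun g hg => hxy g (Finset.mem_union_right _ hg))

theorem isPowSet_empty {ι K : Type*} [CommRing K] : IsPowSet (∅ : Set (ι → K)) :=
  ⟨∅, by simp, by simp⟩

theorem IsPowSet.preimage {ι κ K : Type*} [CommRing K] {S : Set (ι → K)} (hS : IsPowSet S)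
    (e : ι → κ) : IsPowSet {w : κ → K | w ∘ e ∈ S} := by
  classical
  obtain ⟨Λ, hΛ, h⟩ := hS
  refine ⟨Λ.image fun g => (MvPolynomial.rename e g.1, g.2), fun g hg => ?_, fun x y hxy => ?_⟩
  · obtain ⟨g', hg', rfl⟩ := Finset.mem_image.1 hg
    exact hΛ g' hg'
  · refine h _ _ fun g hg => ?_
    have := hxy _ (Finset.mem_image_of_mem _ hg)
    rwa [intEval_rename, intEval_rename] at this

variable {p : ℕ} [Fact p.Prime]

theorem Padic.eq_zero_iff_isNthPow (a : ℚ_[p]) :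
    a = 0 ↔ IsNthPow 2 a ∧ IsNthPow 2 ((p : ℚ_[p]) * a) := by
  constructor
  · rintro rfl
    exact ⟨⟨0, by simp⟩, ⟨0, by simp⟩⟩
  · rintro ⟨⟨x, rfl⟩, ⟨y, hy⟩⟩
    by_contra h
    have hx : x ≠ 0 := by rintro rfl; simp at h
    have hp : (p : ℚ_[p]) ≠ 0 := NeZero.ne _
    have h1 := congrArg Padic.valuation hy
    rw [Padic.valuation_pow, Padic.valuation_mul hp h, Padic.valuation_pow, Padic.valuation_p] at h1
    push_cast at h1
    omega

theorem isPowSet_eq_zero {ι : Type*} (P : MvPolynomial ι ℤ) :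
    IsPowSet {x : ι → ℚ_[p] | intEval x P = 0} := by
  classical
  refine ⟨{(P, 2), ((p : MvPolynomial ι ℤ) * P, 2)}, by simp, fun x y hxy => ?_⟩
  have h1 := hxy (P, 2) (by simp)
  have h2 := hxy ((p : MvPolynomial ι ℤ) * P, 2) (by simp)
  simp only [map_mul, map_natCast] at h1 h2
  rw [Set.mem_ofPred_eq, Set.mem_ofPred_eq, Padic.eq_zero_iff_isNthPow, h1, h2,
    ← Padic.eq_zero_iff_isNthPow]

theorem eventually_isNthPow_intEval_iff {ι T : Type*} (U : Ultrafilter T) (x : ι → T → ℚ_[p])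
    (Λ : Finset (MvPolynomial ι ℤ × ℕ)) : ∀ᶠ t in U, ∀ g ∈ Λ,
      (IsNthPow g.2 (intEval (fun i => x i t) g.1) ↔
        IsNthPow g.2 (intEval (fun i => (x i : Germ (U : Filter T) ℚ_[p])) g.1)) := by
  rw [Filter.eventually_all_finset]
  intro g hg
  rw [intEval_germ, isNthPow_coe_iff]
  by_cases hU : ∀ᶠ t in U, IsNthPow g.2 (intEval (fun i => x i t) g.1)
  · filter_upwards [hU] with t ht
    simp [ht, hU]
  · filter_upwards [Ultrafilter.eventually_not.2 hU] with t ht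
    simp [ht, hU]

/-- Membership of generic tuples is determined by power conditions. -/
theorem eventually_mem_iff_of_isNthPow_iff {ι T T' : Type*} {S : Set (ι → ℚ_[p])}
    {Λ : Finset (MvPolynomial ι ℤ × ℕ)}
    (hS : ∀ x y : ι → ℚ_[p], (∀ g ∈ Λ, IsNthPow g.2 (intEval x g.1) ↔
      IsNthPow g.2 (intEval y g.1)) → (x ∈ S ↔ y ∈ S))
    {U : Ultrafilter T} {U' : Ultrafilter T'} {x : ι → T → ℚ_[p]} {x' : ι → T' → ℚ_[p]}
    (h : ∀ g ∈ Λ, (IsNthPow g.2 (intEval (fun i => (x i : Germ (U : Filter T) ℚ_[p])) g.1) ↔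
      IsNthPow g.2 (intEval (fun i => (x' i : Germ (U' : Filter T') ℚ_[p])) g.1))) :
    (∀ᶠ t in U, (fun i => x i t) ∈ S) ↔ ∀ᶠ t in U', (fun i => x' i t) ∈ S := by
  have h1 := eventually_isNthPow_intEval_iff U x Λ
  have h2 := eventually_isNthPow_intEval_iff U' x' Λ
  constructor
  · intro hx
    obtain ⟨t, htx, ht⟩ := (hx.and h1).exists
    filter_upwards [h2] with t' ht'
    exact (hS _ _ fun g hg => (ht g hg).trans ((h g hg).trans (ht' g hg).symm)).1 htx
  · intro hx
    obtain ⟨t, htx, ht⟩ := (hx.and h2).exists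
    filter_upwards [h1] with t' ht'
    exact (hS _ _ fun g hg => (ht' g hg).trans ((h g hg).trans (ht g hg).symm)).2 htx

theorem IsPowSet.image_some {ι : Type*} {S : Set (Option ι → ℚ_[p])} (hS : IsPowSet S) :
    IsPowSet {x : ι → ℚ_[p] | ∃ t, (fun o : Option ι => o.elim t x) ∈ S} := by
  classical
  obtain ⟨Λ, hΛ, h⟩ := hS
  set X := {x : ι → ℚ_[p] | ∃ t, (fun o : Option ι => o.elim t x) ∈ S} with hX
  by_contra hcon
  have hcon' : ∀ Λ' : Finset {g : MvPolynomial ι ℤ × ℕ // 0 < g.2}, ∃ x y : ι → ℚ_[p],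
      (∀ g ∈ Λ', (IsNthPow g.1.2 (intEval x g.1.1) ↔ IsNthPow g.1.2 (intEval y g.1.1))) ∧
        x ∈ X ∧ y ∉ X := by
    intro Λ'
    by_contra! hc
    refine hcon ⟨Λ'.image Subtype.val, fun g hg => ?_, fun x y hxy => ?_⟩
    · obtain ⟨g, _, rfl⟩ := Finset.mem_image.1 hg
      exact g.2
    · have h1 : ∀ g ∈ Λ', (IsNthPow g.1.2 (intEval x g.1.1) ↔ IsNthPow g.1.2 (intEval y g.1.1)) :=
        fun g hg => hxy _ (Finset.mem_image_of_mem _ hg)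
      exact ⟨hc x y h1, hc y x fun g hg => (h1 g hg).symm⟩
  choose x y hxy hx hy using hcon'
  choose t ht using hx
  let U := Ultrafilter.of (atTop : Filter (Finset {g : MvPolynomial ι ℤ × ℕ // 0 < g.2}))
  have hU : (U : Filter (Finset {g : MvPolynomial ι ℤ × ℕ // 0 < g.2})) ≤ atTop := Ultrafilter.of_le _
  obtain ⟨t', ht'⟩ := PadicLike.exists_extension (padicLike_germNorm (p := p) U)
    (padicLike_germNorm (p := p) U)
    (fun i => Germ.ofFun (fun s => x s i))
    (fun i => Germ.ofFun (fun s => y s i))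
    (fun P n hn => by
      rw [intEval_germ, intEval_germ, isNthPow_coe_iff, isNthPow_coe_iff]
      refine Filter.eventually_congr (hU ?_)
      filter_upwards [eventually_ge_atTop {⟨(P, n), hn⟩}] with s hs
      exact hxy s ⟨(P, n), hn⟩ (Finset.singleton_subset_iff.1 hs))
    (Germ.ofFun t) Λ hΛ
  induction t' using Germ.inductionOn with | _ t'
  have h1 := eventually_mem_iff_of_isNthPow_iff (U := U) (U' := U)
    (x := fun o => o.elim t fun i s => x s i) (x' := fun o => o.elim t' fun i s => y s i) h (by
      intro g hg
      have e : ∀ (t : Finset {g : MvPolynomial ι ℤ × ℕ // 0 < g.2} → ℚ_[p])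
          (x : Finset {g : MvPolynomial ι ℤ × ℕ // 0 < g.2} → ι → ℚ_[p]),
          (fun o : Option ι => (Germ.ofFun (o.elim t fun i s => x s i) : Germ (U : Filter _) ℚ_[p]))
            = fun o => o.elim (Germ.ofFun t) fun i => Germ.ofFun fun s => x s i := fun t x =>
        funext fun o => by cases o <;> rfl
      rw [e, e]
      exact ht' g hg)
  have h2 := h1.1 (.of_forall fun s => by
    convert ht s using 2 with o
    cases o <;> rfl)
  obtain ⟨s, hs⟩ := h2.exists
  refine hy s ⟨t' s, ?_⟩
  convert hs using 2 with o
  cases o <;> rfl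

end Elimination

section Formula

variable {p : ℕ} [Fact p.Prime]

theorem exists_intEval_eq_realize {ι : Type*} (t : FirstOrder.Language.ring.Term ι) :
    ∃ P : MvPolynomial ι ℤ, ∀ v : ι → ℚ_[p], t.realize v = intEval v P := by
  let _ : FirstOrder.Ring.CompatibleRing ℚ_[p] := FirstOrder.Ring.compatibleRingOfRing ℚ_[p]
  induction t with
  | var i => exact ⟨MvPolynomial.X i, fun v => by simp [intEval]⟩
  | func f ts ih =>
    choose P hP using ih
    cases f with
    | add =>
      refine ⟨P 0 + P 1, fun v => ?_⟩
      rw [map_add, ← hP, ← hP]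
      exact FirstOrder.Ring.CompatibleRing.funMap_add _
    | mul =>
      refine ⟨P 0 * P 1, fun v => ?_⟩
      rw [map_mul, ← hP, ← hP]
      exact FirstOrder.Ring.CompatibleRing.funMap_mul _
    | neg =>
      refine ⟨- P 0, fun v => ?_⟩
      rw [map_neg, ← hP]
      exact FirstOrder.Ring.CompatibleRing.funMap_neg _
    | zero =>
      refine ⟨0, fun v => ?_⟩
      rw [map_zero]
      exact FirstOrder.Ring.CompatibleRing.funMap_zero _
    | one =>
      refine ⟨1, fun v => ?_⟩
      rw [map_one]
      exact FirstOrder.Ring.CompatibleRing.funMap_one _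

/-- Quantifier elimination: sets defined by formulas in the language of rings are Boolean
combinations of power conditions. -/
theorem isPowSet_boundedFormula {α : Type*} {n : ℕ}
    (φ : FirstOrder.Language.ring.BoundedFormula α n) :
    IsPowSet {w : α ⊕ Fin n → ℚ_[p] | φ.Realize (w ∘ Sum.inl) (w ∘ Sum.inr)} := by
  induction φ with
  | falsum => exact isPowSet_empty
  | equal t₁ t₂ =>
    obtain ⟨P₁, h₁⟩ := exists_intEval_eq_realize (p := p) t₁
    obtain ⟨P₂, h₂⟩ := exists_intEval_eq_realize (p := p) t₂
    convert isPowSet_eq_zero (p := p) (P₁ - P₂) using 2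
    ext w
    simp only [FirstOrder.Language.BoundedFormula.Realize, h₁, h₂, Sum.elim_comp_inl_inr, map_sub,
      sub_eq_zero]
  | rel R => exact isEmptyElim R
  | imp φ₁ φ₂ h₁ h₂ =>
    convert h₁.compl.union h₂ using 1
    ext w
    exact imp_iff_not_or
  | @all k φ h =>
    let e : α ⊕ Fin (k + 1) → Option (α ⊕ Fin k) :=
      Sum.elim (fun a => some (Sum.inl a)) (Fin.lastCases none fun i => some (Sum.inr i))
    convert (h.compl.preimage e).image_some.compl using 1
    ext w
    have key : ∀ a : ℚ_[p], φ.Realize (((fun o : Option (α ⊕ Fin k) => o.elim a w) ∘ e) ∘ Sum.inl)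
        (((fun o : Option (α ⊕ Fin k) => o.elim a w) ∘ e) ∘ Sum.inr) ↔
        φ.Realize (w ∘ Sum.inl) (Fin.snoc (w ∘ Sum.inr) a) := by
      intro a
      have h : ((fun o : Option (α ⊕ Fin k) => o.elim a w) ∘ e) ∘ Sum.inr
          = (Fin.snoc (w ∘ Sum.inr) a : Fin (k + 1) → ℚ_[p]) := by
        funext i
        refine Fin.lastCases ?_ (fun i => ?_) i <;> simp [e]
      rw [h]
      rfl
    simp only [Set.mem_ofPred_eq, Set.mem_compl_iff, FirstOrder.Language.BoundedFormula.realize_all,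
      not_exists, not_not, key]

theorem isPowSet_of_definable {ι : Type*} {S : Set (ι → ℚ_[p])}
    (hS : Set.Definable (Set.univ : Set ℚ_[p]) FirstOrder.Language.ring S) :
    ∃ S' : Set (ℚ_[p] ⊕ ι → ℚ_[p]), IsPowSet S' ∧ ∀ v, v ∈ S ↔ Sum.elim id v ∈ S' := by
  obtain ⟨φ, rfl⟩ := Set.definable_iff_exists_formula_sum.1 hS
  refine ⟨_, (isPowSet_boundedFormula (p := p) φ).preimage
    (Sum.elim (Sum.map Subtype.val id) Fin.elim0), fun v => ?_⟩
  have key : ∀ (w w' : Set.univ (α := ℚ_[p]) ⊕ ι → ℚ_[p]) (z : Fin 0 → ℚ_[p]), w = w' →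
      (φ.Realize w ↔ FirstOrder.Language.BoundedFormula.Realize φ w' z) := by
    rintro w _ z rfl
    rw [FirstOrder.Language.Formula.Realize]
    exact iff_of_eq (congrArg _ (Subsingleton.elim _ _))
  refine key _ _ _ ?_
  funext i
  rcases i with i | i <;> rfl

end Formula

namespace Padic

variable {p : ℕ} [Fact p.Prime]

theorem norm_p_le_norm_prime {q : ℕ} (hq : q.Prime) : ‖(p : ℚ_[p])‖ ≤ ‖(q : ℚ_[p])‖ := by
  by_cases h : p = q
  · exact h ▸ le_rfl
  · rw [Padic.norm_natCast_eq_one_iff.2 ((Nat.coprime_primes Fact.out hq).2 h)]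
    exact Padic.norm_p_lt_one.le

theorem eq_one_of_norm_sub_one_lt {η : ℤ_[p]} (hη : ‖η - 1‖ < ‖(p : ℚ_[p])‖) {n : ℕ} (hn : 0 < n)
    (h : η ^ n = 1) : η = 1 := by
  by_contra hne
  have hfin : IsOfFinOrder η := isOfFinOrder_iff_pow_eq_one.2 ⟨n, hn, h⟩
  have hord : orderOf η ≠ 1 := fun h => hne (orderOf_eq_one_iff.1 h)
  obtain ⟨q, hq, hqd⟩ := Nat.exists_prime_and_dvd hord
  set θ := η ^ (orderOf η / q) with hθ
  have hθq : θ ^ q = 1 := by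
    rw [hθ, ← pow_mul, Nat.div_mul_cancel hqd, pow_orderOf_eq_one]
  have hθ1 : θ ≠ 1 := by
    intro h
    have h1 := orderOf_dvd_of_pow_eq_one h
    have h2 := Nat.le_of_dvd (Nat.div_pos (Nat.le_of_dvd hfin.orderOf_pos hqd) hq.pos) h1
    exact absurd h2 (not_le.2 (Nat.div_lt_self hfin.orderOf_pos hq.one_lt))
  have hgeom : ∑ i ∈ Finset.range q, θ ^ i = 0 := by
    have := geom_sum_mul θ q
    rw [hθq, sub_self] at this
    exact (mul_eq_zero.1 this).resolve_right (sub_ne_zero.2 hθ1)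
  have hdvd : η - 1 ∣ (q : ℤ_[p]) := by
    have h1 : η - 1 ∣ ∑ i ∈ Finset.range q, (θ ^ i - 1) := by
      refine Finset.dvd_sum fun i _ => ?_
      rw [hθ, ← pow_mul]
      simpa using sub_dvd_pow_sub_pow η 1 (orderOf η / q * i)
    rw [Finset.sum_sub_distrib, hgeom] at h1
    simpa using h1
  obtain ⟨r, hr⟩ := hdvd
  have h1 : ‖(q : ℚ_[p])‖ = ‖η - 1‖ * ‖r‖ := by
    rw [← norm_mul, ← hr]; rfl
  have h2 : ‖η - 1‖ * ‖r‖ ≤ ‖η - 1‖ :=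
    mul_le_of_le_one_right (norm_nonneg _) (PadicInt.norm_le_one r)
  linarith [norm_p_le_norm_prime (p := p) hq]

/-- The roots of unity of `ℚ_[p]` have bounded order. -/
theorem exists_pow_eq_one (p : ℕ) [Fact p.Prime] : ∃ ω : ℕ, 0 < ω ∧
    ∀ (ζ : ℚ_[p]) (n : ℕ), 0 < n → ζ ^ n = 1 → ζ ^ ω = 1 := by
  have hp : p.Prime := Fact.out
  refine ⟨(p ^ 2).totient, Nat.totient_pos.2 (pow_pos hp.pos 2), fun ζ n hn h => ?_⟩
  have hζ : ‖ζ‖ ≤ 1 := by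
    have := congrArg norm h
    rw [norm_pow, norm_one] at this
    exact ((pow_eq_one_iff_of_nonneg (norm_nonneg _) hn.ne').1 this).le
  obtain ⟨u, rfl⟩ : ∃ u : ℤ_[p], (u : ℚ_[p]) = ζ := ⟨⟨ζ, hζ⟩, rfl⟩
  have hu : u ^ n = 1 := PadicInt.ext (by rw [PadicInt.coe_pow, h, PadicInt.coe_one])
  have h1 : PadicInt.toZModPow 2 (u ^ (p ^ 2).totient - 1) = 0 := by
    have hunit : IsUnit (PadicInt.toZModPow 2 u) := by
      refine IsUnit.of_pow_eq_one (n := n) ?_ hn.ne'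
      rw [← map_pow, hu, map_one]
    obtain ⟨v, hv⟩ := hunit
    rw [map_sub, map_pow, map_one, ← hv, ← Units.val_pow_eq_pow_val, ZMod.pow_totient]
    simp
  rw [← RingHom.mem_ker, PadicInt.ker_toZModPow, ← PadicInt.norm_le_pow_iff_mem_span_pow] at h1
  have h2 : u ^ (p ^ 2).totient = 1 := by
    refine eq_one_of_norm_sub_one_lt (h1.trans_lt ?_) hn
      (by rw [← pow_mul, mul_comm, pow_mul, hu, one_pow])
    rw [Padic.norm_p, ← zpow_neg_one]
    exact zpow_lt_zpow_right₀ (by exact_mod_cast hp.one_lt) (by norm_num)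
  exact_mod_cast congrArg (fun t : ℤ_[p] => (t : ℚ_[p])) h2

/-- Rational power maps exist on the group of `b`-th powers, for suitable denominators `b`. -/
theorem exists_powMap {ω : ℕ} (hω : ∀ (ζ : ℚ_[p]) (n : ℕ), 0 < n → ζ ^ n = 1 → ζ ^ ω = 1)
    {b : ℕ} (hb : 0 < b) (k : ℤ) :
    ∃ h : ℚ_[p] → ℚ_[p], ∀ z : ℚ_[p], z ≠ 0 → h (z ^ b) = z ^ (k * ω) := by
  classical
  refine ⟨fun x => if hx : ∃ z, z ^ b = x then hx.choose ^ (k * ω) else 0, fun z hz => ?_⟩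
  have hx : ∃ y, y ^ b = z ^ b := ⟨z, rfl⟩
  simp only [hx, dite_true]
  set y := hx.choose
  have hy : y ^ b = z ^ b := hx.choose_spec
  have h1 : (y / z) ^ ω = 1 := hω _ b hb (by rw [div_pow, hy, div_self (pow_ne_zero _ hz)])
  have h2 : y ^ ω = z ^ ω := by
    rwa [div_pow, div_eq_one_iff_eq (pow_ne_zero _ hz)] at h1
  rw [mul_comm, zpow_mul, zpow_mul, zpow_natCast, zpow_natCast, h2]

end Padic

theorem Polynomial.exists_eq_X_pow_mul {F : Type*} [Field F] {P : F[X]} (hP : P ≠ 0) :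
    ∃ (k : ℕ) (c : F) (Q : F[X]), c ≠ 0 ∧ P = X ^ k * (C c + X * Q) := by
  obtain ⟨Q, hQ, hd⟩ := exists_eq_pow_rootMultiplicity_mul_and_not_dvd P hP 0
  rw [map_zero, sub_zero] at hQ hd
  refine ⟨rootMultiplicity 0 P, Q.coeff 0, Q.divX, fun h => hd (X_dvd_iff.2 h), hQ.trans ?_⟩
  congr 1
  rw [add_comm]
  exact Q.X_mul_divX_add.symm

theorem exists_lt_norm_pow {p : ℕ} [Fact p.Prime] {c : ℚ_[p]} (hc : c ≠ 0) :
    ∃ M : ℕ, ‖(p : ℚ_[p])‖ ^ M ≤ ‖c‖ := by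
  obtain ⟨M, hM⟩ := exists_pow_lt_of_lt_one (norm_pos_iff.2 hc) (Padic.norm_p_lt_one (p := p))
  exact ⟨M, hM.le⟩

namespace PadicLike

variable {p : ℕ} [Fact p.Prime] {K R : Type*} [Field K] [Field R] [LinearOrder R]
  [IsStrictOrderedRing R] {N : AbsoluteValue K R}

/-- `x` is a nonzero element that is infinitesimal and infinitely divisible over the image of
`ℚ_[p]` under the isometric embedding `ι`. -/
structure IsGeneric (N : AbsoluteValue K R) (ι : ℚ_[p] →+* K) (x : K) : Prop where
  norm_le_iff : ∀ c d, N (ι c) ≤ N (ι d) ↔ ‖c‖ ≤ ‖d‖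
  isNthPow_iff : ∀ n c, IsNthPow n (ι c) ↔ IsNthPow n c
  ne_zero : x ≠ 0
  lt : ∀ c, c ≠ 0 → N x < N (ι c)
  isNthPow : ∀ n, 0 < n → IsNthPow n x

namespace IsGeneric

variable {ι : ℚ_[p] →+* K} {x : K} (hx : IsGeneric N ι x)
include hx

theorem lt_one : N x < 1 := by
  simpa using hx.lt 1 one_ne_zero

theorem pos : 0 < N x := N.pos hx.ne_zero

theorem exists_eval_le (hN : PadicLike p N) (Q : ℚ_[p][X]) :
    ∃ b, b ≠ 0 ∧ N (Q.eval₂ ι x) ≤ N (ι b) := by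
  induction Q using Polynomial.induction_on' with
  | add P Q hP hQ =>
    obtain ⟨a, ha, hP⟩ := hP
    obtain ⟨b, hb, hQ⟩ := hQ
    rw [eval₂_add]
    rcases le_total (N (ι a)) (N (ι b)) with h | h
    · exact ⟨b, hb, (hN.add_le_max _ _).trans (max_le (hP.trans h) hQ)⟩
    · exact ⟨a, ha, (hN.add_le_max _ _).trans (max_le hP (hQ.trans h))⟩
  | monomial n a =>
    rw [eval₂_monomial, map_mul, map_pow]
    by_cases ha : a = 0
    · exact ⟨1, one_ne_zero, by simp [ha]⟩
    · exact ⟨a, ha, mul_le_of_le_one_right (N.nonneg _) (pow_le_one₀ (N.nonneg _) hx.lt_one.le)⟩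

theorem mul_eval_lt (hN : PadicLike p N) (Q : ℚ_[p][X]) {d : ℚ_[p]} (hd : d ≠ 0) :
    N (x * Q.eval₂ ι x) < N (ι d) := by
  obtain ⟨b, hb, hQ⟩ := hx.exists_eval_le hN Q
  have hb' : 0 < N (ι b) := N.pos ((map_ne_zero ι).2 hb)
  have h := mul_lt_mul_of_pos_right (hx.lt (d / b) (div_ne_zero hd hb)) hb'
  rw [← map_mul, ← map_mul, ← map_mul, div_mul_cancel₀ _ hb, map_mul] at h
  rw [map_mul]
  exact (mul_le_mul_of_nonneg_left hQ (N.nonneg _)).trans_lt h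

theorem eval_isNthPow_iff {k n : ℕ} (hn : 0 < n) (c : ℚ_[p]) :
    IsNthPow n (ι c * x ^ k) ↔ IsNthPow n c := by
  obtain ⟨y, rfl⟩ := hx.isNthPow n hn
  have hy : y ≠ 0 := by
    rintro rfl
    exact hx.ne_zero (zero_pow hn.ne')
  rw [← pow_mul, mul_comm n, pow_mul, isNthPow_mul_pow_iff (pow_ne_zero _ hy), hx.isNthPow_iff]

theorem leading (hN : PadicLike p N) {c : ℚ_[p]} (hc : c ≠ 0) (k : ℕ) (Q : ℚ_[p][X]) :
    eval₂ ι x (X ^ k * (C c + X * Q)) ≠ 0 ∧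
      N (eval₂ ι x (X ^ k * (C c + X * Q))) = N (ι c) * N x ^ k ∧
      ∀ n, 0 < n → (IsNthPow n (eval₂ ι x (X ^ k * (C c + X * Q))) ↔ IsNthPow n c) := by
  have hc' : 0 < N (ι c) := N.pos ((map_ne_zero ι).2 hc)
  have hval : eval₂ ι x (X ^ k * (C c + X * Q)) = (ι c + x * Q.eval₂ ι x) * x ^ k := by
    simp only [eval₂_mul, eval₂_add, eval₂_C, eval₂_X, eval₂_pow]
    ring
  have hnorm : N (eval₂ ι x (X ^ k * (C c + X * Q))) = N (ι c) * N x ^ k := by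
    rw [hval, map_mul, map_pow, hN.eq_of_sub_lt (y := ι c)]
    rw [add_sub_cancel_left]
    exact hx.mul_eval_lt hN Q hc
  refine ⟨?_, hnorm, fun n hn => ?_⟩
  · intro h
    rw [h, map_zero] at hnorm
    exact (mul_pos hc' (_root_.pow_pos hx.pos k)).ne hnorm
  · obtain ⟨M, hM⟩ := hN.exists_isNthPow_congr n hn
    rw [hval, ← hx.eval_isNthPow_iff hn c (k := k)]
    have hp : (p : ℚ_[p]) ≠ 0 := NeZero.ne _
    refine hM M le_rfl _ _ ?_
    rw [← sub_mul, add_sub_cancel_left, N.map_mul, N.map_mul (ι c), ← mul_assoc]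
    refine mul_le_mul_of_nonneg_right ?_ (N.nonneg _)
    have := (hx.mul_eval_lt hN Q (mul_ne_zero (pow_ne_zero M hp) hc)).le
    rwa [map_mul ι, map_pow, map_natCast, N.map_mul (_ ^ _), map_pow] at this

/-- A nonzero element that is algebraic over `ℚ_[p][x]` has the norm of a fractional monomial. -/
theorem exists_norm_pow_eq (hN : PadicLike p N) {F : ℚ_[p][X][X]} (hF : F ≠ 0) {y : K}
    (hy : y ≠ 0) (h : F.eval₂ (eval₂RingHom ι x) y = 0) :
    ∃ (e : ℕ) (c : ℚ_[p]) (k : ℤ), 0 < e ∧ c ≠ 0 ∧ N y ^ e = N (ι c) * N x ^ k := by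
  classical
  have hy' := N.pos hy
  have key : ∃ i ∈ F.support, ∃ j ∈ F.support, i < j ∧
      N (eval₂ ι x (F.coeff i) * y ^ i) = N (eval₂ ι x (F.coeff j) * y ^ j) := by
    obtain ⟨i, hi, hmax⟩ := F.support.exists_max_image
      (fun i => N (eval₂ ι x (F.coeff i) * y ^ i)) (support_nonempty.2 hF)
    have hpos : 0 < N (eval₂ ι x (F.coeff i) * y ^ i) := by
      obtain ⟨k, c, Q, hc, hk⟩ := exists_eq_X_pow_mul (mem_support_iff.1 hi)
      exact N.pos (mul_ne_zero (hk ▸ (hx.leading hN hc k Q).1) (pow_ne_zero _ hy))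
    have : ∃ j ∈ F.support.erase i, N (eval₂ ι x (F.coeff i) * y ^ i)
        ≤ N (eval₂ ι x (F.coeff j) * y ^ j) := by
      by_contra! hlt
      have h1 := hN.sum_lt _ _ hpos hlt
      rw [eval₂_eq_sum, Polynomial.sum, ← Finset.add_sum_erase _ _ hi] at h
      simp only [coe_eval₂RingHom] at h
      rw [eq_neg_of_add_eq_zero_right h, N.map_neg] at h1
      exact h1.false
    obtain ⟨j, hj, hij⟩ := this
    obtain ⟨hne, hj⟩ := Finset.mem_erase.1 hj
    have heq := hij.antisymm (hmax j hj)
    rcases hne.lt_or_gt with hlt | hlt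
    · exact ⟨j, hj, i, hi, hlt, heq.symm⟩
    · exact ⟨i, hi, j, hj, hlt, heq⟩
  obtain ⟨i, hi, j, hj, hij, heq⟩ := key
  obtain ⟨k, c, Q, hc, hP⟩ := exists_eq_X_pow_mul (mem_support_iff.1 hi)
  obtain ⟨l, d, Q', hd, hP'⟩ := exists_eq_X_pow_mul (mem_support_iff.1 hj)
  have hk := (hx.leading hN hc k Q).2.1
  have hl := (hx.leading hN hd l Q').2.1
  rw [← hP] at hk
  rw [← hP'] at hl
  refine ⟨j - i, c / d, k - l, by omega, div_ne_zero hc hd, ?_⟩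
  have hd' : N (ι d) ≠ 0 := N.ne_zero ((map_ne_zero ι).2 hd)
  have hj' : N y ^ j = N y ^ i * N y ^ (j - i) := by rw [← pow_add, Nat.add_sub_cancel' hij.le]
  rw [map_mul, map_mul, map_pow, map_pow, hk, hl, hj'] at heq
  have hxk := hx.pos.ne'
  rw [zpow_sub₀ hxk, zpow_natCast, zpow_natCast, map_div₀, map_div₀]
  field_simp
  apply mul_right_cancel₀ (pow_ne_zero i hy'.ne')
  rw [heq]
  ring

end IsGeneric

/-- The elements of `K` that are algebraic over `ℚ_[p][x]`. -/
theorem exists_algebraic_subfield (ι : ℚ_[p] →+* K) (x : K) : ∃ A : Subfield K, (∀ d, RootClosed A d) ∧ x ∈ A ∧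
    (∀ c, ι c ∈ A) ∧ ∀ y ∈ A, ∃ F : ℚ_[p][X][X], F ≠ 0 ∧ F.eval₂ (eval₂RingHom ι x) y = 0 := by
  let _ : Algebra ℚ_[p][X] K := (eval₂RingHom ι x).toAlgebra
  let B := Subalgebra.algebraicClosure ℚ_[p][X] K
  let A : Subfield K := { B with
    neg_mem' := fun {y} hy => IsAlgebraic.neg hy
    inv_mem' := fun y hy => IsAlgebraic.inv hy }
  have hmem : ∀ P : ℚ_[p][X], P.eval₂ ι x ∈ A := fun P => B.algebraMap_mem P
  refine ⟨A, fun d f hf _ hfA y hy => ?_, by simpa using hmem X, fun c => by simpa using hmem (C c),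
    fun y hy => hy⟩
  let g : B[X] := f.toSubring B.toSubring fun c hc => by
    obtain ⟨i, -, rfl⟩ := mem_coeffs_iff.1 hc
    exact hfA i
  have hg : g.map (algebraMap B K) = f := f.map_toSubring B.toSubring _
  have : IsAlgebraic B y := by
    refine ⟨g, fun h0 => hf (by rw [← hg, h0, Polynomial.map_zero]), ?_⟩
    rw [← eval_map_algebraMap, hg]
    exact hy
  exact this.restrictScalars _

/-- The correspondence between two generic elements respects powers. -/
theorem respectsPow_of_isGeneric {K' R' : Type*} [Field K'] [Field R'] [LinearOrder R']
    [IsStrictOrderedRing R'] {N' : AbsoluteValue K' R'} (hN : PadicLike p N)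
    (hN' : PadicLike p N') {ι : ℚ_[p] →+* K} {ι' : ℚ_[p] →+* K'} {x : K} {x' : K'}
    (hx : IsGeneric N ι x) (hx' : IsGeneric N' ι' x') :
    ∃ Γ : Subring (K × K'), RespectsPow Γ ∧ (x, x') ∈ Γ ∧ ∀ c, (ι c, ι' c) ∈ Γ := by
  refine ⟨((eval₂RingHom ι x).prod (eval₂RingHom ι' x')).range, ?_, ⟨X, by simp⟩,
    fun c => ⟨C c, by simp⟩⟩
  rintro _ ⟨P, rfl⟩ n hn
  simp only [RingHom.prod_apply, coe_eval₂RingHom]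
  by_cases hP : P = 0
  · subst hP
    simp only [eval₂_zero]
    exact iff_of_true ⟨0, zero_pow hn.ne'⟩ ⟨0, zero_pow hn.ne'⟩
  obtain ⟨k, c, Q, hc, rfl⟩ := exists_eq_X_pow_mul hP
  rw [(hx.leading hN hc k Q).2.2 n hn, (hx'.leading hN' hc k Q).2.2 n hn]

end PadicLike

section PowFilter

variable (p : ℕ) [Fact p.Prime]

/-- The filter generated by the sets of nonzero `m`-th powers of valuation at least `δ`. -/
def powFilter : Filter ℚ_[p] where
  sets := {A | ∃ (δ : ℤ) (m : ℕ), 0 < m ∧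
    ∀ x : ℚ_[p], x ≠ 0 → δ ≤ x.valuation → IsNthPow m x → x ∈ A}
  univ_sets := ⟨0, 1, one_pos, fun _ _ _ _ => trivial⟩
  sets_of_superset := by
    rintro A B ⟨δ, m, hm, h⟩ hAB
    exact ⟨δ, m, hm, fun x hx hv hp => hAB (h x hx hv hp)⟩
  inter_sets := by
    rintro A B ⟨δ, m, hm, h⟩ ⟨δ', m', hm', h'⟩
    refine ⟨max δ δ', m * m', mul_pos hm hm', ?_⟩
    rintro x hx hv ⟨y, rfl⟩
    exact ⟨h _ hx ((le_max_left _ _).trans hv) ⟨y ^ m', by rw [← pow_mul, mul_comm]⟩,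
      h' _ hx ((le_max_right _ _).trans hv) ⟨y ^ m, by rw [← pow_mul]⟩⟩

variable {p}

theorem mem_powFilter {A : Set ℚ_[p]} : A ∈ powFilter p ↔ ∃ (δ : ℤ) (m : ℕ), 0 < m ∧
    ∀ x : ℚ_[p], x ≠ 0 → δ ≤ x.valuation → IsNthPow m x → x ∈ A := Iff.rfl

instance : (powFilter p).NeBot := by
  refine ⟨fun h => ?_⟩
  obtain ⟨δ, m, hm, h⟩ := mem_powFilter.1 (h ▸ mem_bot : (∅ : Set ℚ_[p]) ∈ powFilter p)
  have hp : (p : ℚ_[p]) ≠ 0 := NeZero.ne _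
  refine h ((p ^ δ.toNat : ℚ_[p]) ^ m) (pow_ne_zero _ (pow_ne_zero _ hp)) ?_ ⟨_, rfl⟩
  rw [Padic.valuation_pow, Padic.valuation_pow, Padic.valuation_p]
  have h1 : (1 : ℤ) ≤ m := by exact_mod_cast hm
  have h2 := Int.self_le_toNat δ
  nlinarith [Int.natCast_nonneg δ.toNat]

theorem eventually_ne_zero_powFilter : ∀ᶠ x in powFilter p, x ≠ 0 :=
  ⟨0, 1, one_pos, fun _ hx _ _ => hx⟩

theorem eventually_isNthPow_powFilter {m : ℕ} (hm : 0 < m) : ∀ᶠ x in powFilter p, IsNthPow m x :=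
  ⟨0, m, hm, fun _ _ _ h => h⟩

theorem eventually_norm_lt_powFilter {c : ℚ_[p]} (hc : c ≠ 0) :
    ∀ᶠ x in powFilter p, ‖x‖ < ‖c‖ := by
  refine ⟨c.valuation + 1, 1, one_pos, fun x hx hv _ => ?_⟩
  show ‖x‖ < ‖c‖
  rw [Padic.norm_eq_zpow_neg_valuation hx, Padic.norm_eq_zpow_neg_valuation hc]
  exact zpow_lt_zpow_right₀ (by exact_mod_cast (Fact.out : p.Prime).one_lt) (by omega)

/-- The embedding of the constants into an ultrapower. -/
noncomputable def germConst {T : Type*} (U : Ultrafilter T) : ℚ_[p] →+* Germ (U : Filter T) ℚ_[p] :=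
  (Germ.coeRingHom (U : Filter T)).comp (Pi.constRingHom T ℚ_[p])

theorem germConst_apply {T : Type*} (U : Ultrafilter T) (c : ℚ_[p]) :
    germConst U c = Germ.ofFun fun _ => c := rfl

theorem isGeneric_germ {U : Ultrafilter ℚ_[p]} (hU : ↑U ≤ powFilter p) :
    PadicLike.IsGeneric (germNorm (p := p) U) (germConst U) (Germ.ofFun id) where
  norm_le_iff c d := by
    rw [germConst_apply, germConst_apply]
    exact Germ.coe_le.trans (Filter.eventually_const (p := ‖c‖ ≤ ‖d‖))
  isNthPow_iff n c := 
    isNthPow_coe_iff.trans (Filter.eventually_const (p := IsNthPow n c))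
  ne_zero h := by
    have h0 : ∀ᶠ x in U, x ≠ (0 : ℚ_[p]) := hU eventually_ne_zero_powFilter
    obtain ⟨x, hx, hx'⟩ := (h0.and (Germ.coe_eq.1 h)).exists
    exact hx hx'
  lt c hc := Germ.coe_lt.2 (hU (eventually_norm_lt_powFilter hc))
  isNthPow n hn := isNthPow_coe_iff.2 (hU (eventually_isNthPow_powFilter hn))

end PowFilter

section Graph

/-- The tuple consisting of a family of constants and a pair of elements. -/
def graphTuple {κ L : Type*} (ι : κ → L) (x y : L) : κ ⊕ Fin 2 → L := Sum.elim ι ![x, y]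

theorem map_intEval_graphTuple {κ L K : Type*} [CommRing L] [CommRing K] (φ : L →+* K)
    (ι : κ → L) (x y : L) (P : MvPolynomial (κ ⊕ Fin 2) ℤ) :
    φ (intEval (graphTuple ι x y) P) = intEval (graphTuple (fun c => φ (ι c)) (φ x) (φ y)) P := by
  rw [map_intEval]
  congr 2
  funext i
  rcases i with c | i
  · rfl
  · fin_cases i <;> rfl

variable {p : ℕ} [Fact p.Prime] {f : ℚ_[p] → ℚ_[p]} {S : Set (ℚ_[p] ⊕ Fin 2 → ℚ_[p])}
  {Λ : Finset (MvPolynomial (ℚ_[p] ⊕ Fin 2) ℤ × ℕ)}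

/-- The germ of a function whose graph is a Boolean combination of power conditions is determined
by the power conditions. -/
theorem germ_eq_of_isNthPow_iff (hf : ∀ x y, f x = y ↔ graphTuple id x y ∈ S)
    (hS : ∀ x y : ℚ_[p] ⊕ Fin 2 → ℚ_[p], (∀ g ∈ Λ, IsNthPow g.2 (intEval x g.1) ↔
      IsNthPow g.2 (intEval y g.1)) → (x ∈ S ↔ y ∈ S))
    {U U' : Ultrafilter ℚ_[p]} (z : Germ (U' : Filter ℚ_[p]) ℚ_[p])
    (h : ∀ g ∈ Λ,
      (IsNthPow g.2 (intEval (graphTuple (germConst U) (Germ.ofFun id) (Germ.ofFun f)) g.1) ↔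
        IsNthPow g.2 (intEval (graphTuple (germConst U') (Germ.ofFun id) z) g.1))) :
    z = Germ.ofFun f := by
  induction z using Germ.inductionOn with | _ z
  have e : ∀ (U : Ultrafilter ℚ_[p]) (z : ℚ_[p] → ℚ_[p]),
      graphTuple (germConst U) (Germ.ofFun id) (Germ.ofFun z) =
        fun i => (Germ.ofFun (graphTuple (fun c (_ : ℚ_[p]) => c) id z i) :
          Germ (U : Filter ℚ_[p]) ℚ_[p]) := by
    intro U z
    funext i
    rcases i with c | i
    · rfl
    · fin_cases i <;> rfl
  have e' : ∀ (z : ℚ_[p] → ℚ_[p]) (t : ℚ_[p]),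
      (fun i => graphTuple (fun c (_ : ℚ_[p]) => c) id z i t) = graphTuple id t (z t) := by
    intro z t
    funext i
    rcases i with c | i
    · rfl
    · fin_cases i <;> rfl
  have h1 := eventually_mem_iff_of_isNthPow_iff hS (U := U) (U' := U')
    (x := graphTuple (fun c _ => c) id f) (x' := graphTuple (fun c _ => c) id z) (by
      intro g hg
      have := h g hg
      rwa [e U f, show (z : Germ (U' : Filter ℚ_[p]) ℚ_[p]) = Germ.ofFun z from rfl, e U' z]
        at this)
  simp only [e', ← hf] at h1
  exact Germ.coe_eq.2 ((h1.1 (by simp)).mono fun t ht => ht.symm)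

theorem germ_mem_of_rootClosed (hf : ∀ x y, f x = y ↔ graphTuple id x y ∈ S)
    (hS : ∀ x y : ℚ_[p] ⊕ Fin 2 → ℚ_[p], (∀ g ∈ Λ, IsNthPow g.2 (intEval x g.1) ↔
      IsNthPow g.2 (intEval y g.1)) → (x ∈ S ↔ y ∈ S)) (hΛ : ∀ g ∈ Λ, 0 < g.2)
    (U : Ultrafilter ℚ_[p]) {A : Subfield (Germ (U : Filter ℚ_[p]) ℚ_[p])}
    (hA : ∀ d, PadicLike.RootClosed A d) (hx : Germ.ofFun id ∈ A) (hc : ∀ c, germConst U c ∈ A) :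
    Germ.ofFun f ∈ A := by
  classical
  let G : MvPolynomial (ℚ_[p] ⊕ Fin 2) ℤ → A[X] :=
    fun P => intEval (graphTuple (fun c => C ⟨germConst U c, hc c⟩) (C ⟨Germ.ofFun id, hx⟩) X) P
  have hG : ∀ P z, ((G P).map A.subtype).eval z =
      intEval (graphTuple (germConst U) (Germ.ofFun id) z) P := by
    intro P z
    have := map_intEval_graphTuple ((evalRingHom z).comp (mapRingHom A.subtype))
      (fun c => C ⟨germConst U c, hc c⟩) (C ⟨Germ.ofFun id, hx⟩) X P
    simpa using this
  obtain ⟨z, hz, h⟩ := (padicLike_germNorm (p := p) U).exists_mem_isNthPow_iff hA (Germ.ofFun f)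
    (Λ.image fun g => ((G g.1).map A.subtype, g.2)) (by
      intro g hg
      obtain ⟨g', hg', rfl⟩ := Finset.mem_image.1 hg
      exact ⟨hΛ g' hg', fun i => by simp⟩)
  rwa [← germ_eq_of_isNthPow_iff hf hS (U := U) z fun g hg => by
    have := h _ (Finset.mem_image_of_mem _ hg)
    rw [hG, hG] at this
    exact this.symm]

theorem germ_mem_of_maximal (hf : ∀ x y, f x = y ↔ graphTuple id x y ∈ S)
    (hS : ∀ x y : ℚ_[p] ⊕ Fin 2 → ℚ_[p], (∀ g ∈ Λ, IsNthPow g.2 (intEval x g.1) ↔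
      IsNthPow g.2 (intEval y g.1)) → (x ∈ S ↔ y ∈ S)) (hΛ : ∀ g ∈ Λ, 0 < g.2)
    (U U' : Ultrafilter ℚ_[p])
    {Γ : Subring (Germ (U : Filter ℚ_[p]) ℚ_[p] × Germ (U' : Filter ℚ_[p]) ℚ_[p])}
    (hΓ : Maximal PadicLike.RespectsPow Γ) (hx : (Germ.ofFun id, Germ.ofFun id) ∈ Γ)
    (hc : ∀ c, (germConst U c, germConst U' c) ∈ Γ) :
    (Germ.ofFun f, Germ.ofFun f) ∈ Γ := by
  classical
  let G : MvPolynomial (ℚ_[p] ⊕ Fin 2) ℤ → Γ[X] :=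
    fun P => intEval (graphTuple (fun c => C ⟨_, hc c⟩) (C ⟨_, hx⟩) X) P
  obtain ⟨z, h⟩ := PadicLike.exists_isNthPow_iff_of_maximal (padicLike_germNorm (p := p) U)
    (padicLike_germNorm (p := p) U') hΓ (Germ.ofFun f) (Λ.image fun g => (G g.1, g.2)) (by
      intro g hg
      obtain ⟨g', hg', rfl⟩ := Finset.mem_image.1 hg
      exact hΛ g' hg')
  have hG : ∀ P, ((G P).map (PadicLike.fstHom Γ)).eval (Germ.ofFun f) =
      intEval (graphTuple (germConst U) (Germ.ofFun id) (Germ.ofFun f)) P := by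
    intro P
    have := map_intEval_graphTuple ((evalRingHom (Germ.ofFun f)).comp
      (mapRingHom (PadicLike.fstHom Γ))) (fun c => C ⟨_, hc c⟩) (C ⟨_, hx⟩) X P
    simpa [PadicLike.fstHom] using this
  have hG1 : ∀ P, PadicLike.fstHom Γ ((G P).eval z) =
      intEval (graphTuple (germConst U) (Germ.ofFun id) (PadicLike.fstHom Γ z)) P := by
    intro P
    have := map_intEval_graphTuple ((PadicLike.fstHom Γ).comp (evalRingHom z))
      (fun c => C ⟨_, hc c⟩) (C ⟨_, hx⟩) X P
    simpa [PadicLike.fstHom] using this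
  have hG2 : ∀ P, PadicLike.sndHom Γ ((G P).eval z) =
      intEval (graphTuple (germConst U') (Germ.ofFun id) (PadicLike.sndHom Γ z)) P := by
    intro P
    have := map_intEval_graphTuple ((PadicLike.sndHom Γ).comp (evalRingHom z))
      (fun c => C ⟨_, hc c⟩) (C ⟨_, hx⟩) X P
    simpa [PadicLike.sndHom] using this
  have h1 := germ_eq_of_isNthPow_iff hf hS (U := U) (PadicLike.fstHom Γ z) fun g hg => by
    have := (h _ (Finset.mem_image_of_mem _ hg)).1
    rwa [hG, hG1] at this
  have h2 := germ_eq_of_isNthPow_iff hf hS (U := U) (PadicLike.sndHom Γ z) fun g hg => by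
    have := (h _ (Finset.mem_image_of_mem _ hg)).2
    rwa [hG, hG2] at this
  have hz := z.2
  have hz' : z.1 = (Germ.ofFun f, Germ.ofFun f) := Prod.ext h1 h2
  rwa [hz'] at hz

end Graph

section Asymptotics

namespace PadicLike

variable {p : ℕ} {K R K' R' : Type*} [Field K] [Field R] [LinearOrder R] [IsStrictOrderedRing R]
  [Field K'] [Field R'] [LinearOrder R'] [IsStrictOrderedRing R']
  {N : AbsoluteValue K R} {N' : AbsoluteValue K' R'} {Γ : Subring (K × K')}

theorem inv_mem_of_maximal (hN : PadicLike p N) (hN' : PadicLike p N')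
    (hΓ : Maximal RespectsPow Γ) {a : K × K'} (ha : a ∈ Γ) : a⁻¹ ∈ Γ := by
  obtain ⟨b, hb, hb'⟩ := exists_inv hN hN' hΓ ⟨a, ha⟩
  have : (b : K × K') = a⁻¹ := Prod.ext hb hb'
  exact this ▸ b.2

theorem zpow_mem_of_maximal (hN : PadicLike p N) (hN' : PadicLike p N')
    (hΓ : Maximal RespectsPow Γ) {a : K × K'} (ha : a ∈ Γ) (j : ℤ) : (a.1 ^ j, a.2 ^ j) ∈ Γ := by
  cases j with
  | ofNat n =>
    simp only [Int.ofNat_eq_natCast, zpow_natCast]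
    exact pow_mem ha n
  | negSucc n =>
    simp only [zpow_negSucc]
    exact inv_mem_of_maximal hN hN' hΓ (pow_mem ha (n + 1))

/-- A maximal correspondence can be extended along the extraction of roots. -/
theorem exists_root_mem (hN : PadicLike p N) (hN' : PadicLike p N') (hΓ : Maximal RespectsPow Γ)
    {x : K} {x' : K'} (hx : (x, x') ∈ Γ) {m : ℕ} (hm : 0 < m) {ξ : K} (hξ : ξ ^ m = x) :
    ∃ ζ, (ξ, ζ) ∈ Γ ∧ ζ ^ m = x' := by
  have hξA : ξ ∈ fstField hN hN' hΓ := by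
    refine rootClosed_fstField hN hN' hΓ m (X ^ m - C x) (X_pow_sub_C_ne_zero hm x)
      (natDegree_X_pow_sub_C (n := m)).le (fun i => ?_) ξ (by simp [hξ])
    rw [coeff_sub, coeff_X_pow, coeff_C]
    refine sub_mem (by split_ifs <;> simp) ?_
    split_ifs
    exacts [⟨⟨_, hx⟩, rfl⟩, zero_mem _]
  obtain ⟨a, ha⟩ := (mem_fstField hN hN' hΓ).1 hξA
  refine ⟨sndHom Γ a, by rw [← ha]; exact a.2, ?_⟩
  have h := (fst_eq_zero_iff hN hN' hΓ.prop (a ^ m - ⟨_, hx⟩)).1 (by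
    rw [map_sub, map_pow, ha, hξ]
    exact sub_self _)
  rw [map_sub, map_pow] at h
  exact sub_eq_zero.1 h

theorem eq_iff_eq (hN : PadicLike p N) (hN' : PadicLike p N') (hΓ : Maximal RespectsPow Γ)
    {a b : K × K'} (ha : a ∈ Γ) (hb : b ∈ Γ) : N a.1 = N b.1 ↔ N' a.2 = N' b.2 := by
  rw [le_antisymm_iff, le_antisymm_iff]
  exact and_congr (le_iff_le hN hN' hΓ ⟨a, ha⟩ ⟨b, hb⟩) (le_iff_le hN hN' hΓ ⟨b, hb⟩ ⟨a, ha⟩)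

end PadicLike

variable {p : ℕ} [Fact p.Prime]

theorem germ_zpow {T : Type*} (U : Ultrafilter T) (s : T → ℚ_[p]) (j : ℤ) :
    (Germ.ofFun s : Germ (U : Filter T) ℚ_[p]) ^ j = Germ.ofFun fun t => s t ^ j := by
  cases j with
  | ofNat n =>
    simp only [Int.ofNat_eq_natCast, zpow_natCast]
    rfl
  | negSucc n =>
    simp only [zpow_negSucc]
    rfl

theorem germ_powMap {U : Ultrafilter ℚ_[p]} (hU : ↑U ≤ powFilter p) {h : ℚ_[p] → ℚ_[p]} {m : ℕ}
    (hm : 0 < m) {j : ℤ} (hh : ∀ z, z ≠ 0 → h (z ^ m) = z ^ j)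
    {ξ : Germ (U : Filter ℚ_[p]) ℚ_[p]} (hξ : ξ ^ m = Germ.ofFun id) :
    Germ.ofFun h = ξ ^ j := by
  induction ξ using Germ.inductionOn with | _ s
  have h0 : ∀ᶠ x in U, x ≠ (0 : ℚ_[p]) := hU eventually_ne_zero_powFilter
  have h1 : ∀ᶠ x in U, s x ^ m = x := Germ.coe_eq.1 hξ
  refine Eq.trans ?_ (germ_zpow U s j).symm
  refine Germ.coe_eq.2 ?_
  filter_upwards [h0, h1] with t ht hs
  have : s t ≠ 0 := by
    intro h
    rw [h, zero_pow hm.ne'] at hs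
    exact ht hs.symm
  rw [← hh _ this, hs]

variable {f : ℚ_[p] → ℚ_[p]} {S : Set (ℚ_[p] ⊕ Fin 2 → ℚ_[p])}
  {Λ : Finset (MvPolynomial (ℚ_[p] ⊕ Fin 2) ℤ × ℕ)}

theorem exists_maximal_correspondence {U U' : Ultrafilter ℚ_[p]}
    (hU : ↑U ≤ powFilter p) (hU' : ↑U' ≤ powFilter p) :
    ∃ Γ : Subring (Germ (U : Filter ℚ_[p]) ℚ_[p] × Germ (U' : Filter ℚ_[p]) ℚ_[p]),
      Maximal PadicLike.RespectsPow Γ ∧ (Germ.ofFun id, Germ.ofFun id) ∈ Γ ∧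
      ∀ c, (germConst U c, germConst U' c) ∈ Γ := by
  obtain ⟨Γ₀, h₀, hx, hc⟩ := PadicLike.respectsPow_of_isGeneric (padicLike_germNorm (p := p) U)
    (padicLike_germNorm (p := p) U') (isGeneric_germ hU) (isGeneric_germ hU')
  obtain ⟨Γ, hle, hΓ⟩ := PadicLike.exists_maximal_respectsPow h₀
  exact ⟨Γ, hΓ, hle hx, fun c => hle (hc c)⟩

theorem eventually_eq_zero_of_ultrafilter (hf : ∀ x y, f x = y ↔ graphTuple id x y ∈ S)
    (hS : ∀ x y : ℚ_[p] ⊕ Fin 2 → ℚ_[p], (∀ g ∈ Λ, IsNthPow g.2 (intEval x g.1) ↔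
      IsNthPow g.2 (intEval y g.1)) → (x ∈ S ↔ y ∈ S)) (hΛ : ∀ g ∈ Λ, 0 < g.2)
    {U : Ultrafilter ℚ_[p]} (hU : ↑U ≤ powFilter p) (h : ∀ᶠ x in U, f x = 0) :
    ∀ᶠ x in powFilter p, f x = 0 := by
  refine Filter.mem_iff_ultrafilter.2 fun U' hU' => ?_
  obtain ⟨Γ, hΓ, hx, hc⟩ := exists_maximal_correspondence hU hU'
  have hy := germ_mem_of_maximal hf hS hΛ U U' hΓ hx hc
  exact Germ.coe_eq.1 ((PadicLike.fst_eq_zero_iff (padicLike_germNorm (p := p) U)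
    (padicLike_germNorm (p := p) U') hΓ.prop ⟨_, hy⟩).1 (Germ.coe_eq.2 h))

theorem eventually_norm_eq_of_ultrafilter (hf : ∀ x y, f x = y ↔ graphTuple id x y ∈ S)
    (hS : ∀ x y : ℚ_[p] ⊕ Fin 2 → ℚ_[p], (∀ g ∈ Λ, IsNthPow g.2 (intEval x g.1) ↔
      IsNthPow g.2 (intEval y g.1)) → (x ∈ S ↔ y ∈ S)) (hΛ : ∀ g ∈ Λ, 0 < g.2)
    {U : Ultrafilter ℚ_[p]} (hU : ↑U ≤ powFilter p) {h : ℚ_[p] → ℚ_[p]} {m : ℕ}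
    (hm : 0 < m) {j : ℤ} (hh : ∀ z, z ≠ 0 → h (z ^ m) = z ^ j) (C c : ℚ_[p]) (e l : ℕ)
    (hfU : ∀ᶠ x in U, ‖f x / (C * h x) - 1‖ ^ e = ‖c‖ * ‖x‖ ^ l) :
    ∀ᶠ x in powFilter p, ‖f x / (C * h x) - 1‖ ^ e = ‖c‖ * ‖x‖ ^ l := by
  refine Filter.mem_iff_ultrafilter.2 fun U' hU' => ?_
  obtain ⟨Γ, hΓ, hx, hc⟩ := exists_maximal_correspondence hU hU'
  have hN := padicLike_germNorm (p := p) U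
  have hN' := padicLike_germNorm (p := p) U'
  have hy := germ_mem_of_maximal hf hS hΛ U U' hΓ hx hc
  obtain ⟨ξ, hξ⟩ := (isGeneric_germ hU).isNthPow m hm
  obtain ⟨ζ, hξζ, hζ⟩ := PadicLike.exists_root_mem hN hN' hΓ hx hm hξ
  have hη := PadicLike.zpow_mem_of_maximal hN hN' hΓ hξζ j
  simp only at hη
  rw [← germ_powMap hU hm hh hξ, ← germ_powMap hU' hm hh hζ] at hη
  have hw := pow_mem (sub_mem (mul_mem hy (PadicLike.inv_mem_of_maximal hN hN' hΓ
    (mul_mem (hc C) hη))) (one_mem Γ)) e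
  have key := (PadicLike.eq_iff_eq hN hN' hΓ hw (mul_mem (hc c) (pow_mem hx l))).1 (Germ.coe_eq.2 (by
    filter_upwards [hfU] with t ht
    simpa [div_eq_mul_inv] using ht))
  filter_upwards [Germ.coe_eq.1 key] with t ht
  simpa [div_eq_mul_inv] using ht

theorem exists_tendsto_of_norm_pow_eq (U : Ultrafilter ℚ_[p]) {v : ℚ_[p] → ℚ_[p]} {m : ℕ}
    (hm : 0 < m) {c : ℚ_[p]} (hc : c ≠ 0) (h : ∀ᶠ t in U, ‖v t‖ ^ m = ‖c‖) :
    ∃ C, C ≠ 0 ∧ Tendsto v U (𝓝 C) := by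
  have hball : ∀ᶠ t in U, v t ∈ Metric.closedBall (0 : ℚ_[p]) (max 1 ‖c‖) := by
    filter_upwards [h] with t ht
    rw [mem_closedBall_zero_iff]
    rcases le_total ‖v t‖ 1 with h1 | h1
    · exact h1.trans (le_max_left _ _)
    · exact (le_self_pow₀ h1 hm.ne').trans (ht.le.trans (le_max_right _ _))
  obtain ⟨C, -, hC⟩ := (isCompact_closedBall (0 : ℚ_[p]) (max 1 ‖c‖)).ultrafilter_le_nhds (U.map v)
    (le_principal_iff.2 hball)
  have hC' : Tendsto v U (𝓝 C) := hC
  refine ⟨C, ?_, hC'⟩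
  rintro rfl
  have h1 : Tendsto (fun t => ‖v t‖ ^ m) U (𝓝 (‖(0 : ℚ_[p])‖ ^ m)) := hC'.norm.pow m
  have h2 : Tendsto (fun t => ‖v t‖ ^ m) U (𝓝 ‖c‖) := tendsto_const_nhds.congr' (h.mono fun t ht => ht.symm)
  have := tendsto_nhds_unique h1 h2
  rw [norm_zero, zero_pow hm.ne'] at this
  exact hc (norm_eq_zero.1 this.symm)

namespace PadicLike.IsGeneric

variable {K R : Type*} [Field K] [Field R] [LinearOrder R] [IsStrictOrderedRing R]
  {N : AbsoluteValue K R} {ι : ℚ_[p] →+* K} {x : K}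

/-- The norm of an algebraic infinitesimal is a positive fractional power of that of `x`. -/
theorem exists_norm_pow_eq_of_infinitesimal (hx : IsGeneric N ι x) (hN : PadicLike p N)
    {F : ℚ_[p][X][X]} (hF : F ≠ 0) {w : K} (h : F.eval₂ (eval₂RingHom ι x) w = 0)
    (hw : ∀ d, d ≠ 0 → N w < N (ι d)) :
    ∃ (e l : ℕ) (c : ℚ_[p]), 0 < e ∧ 0 < l ∧ N w ^ e = N (ι c) * N x ^ l := by
  by_cases hw0 : w = 0
  · exact ⟨1, 1, 0, one_pos, one_pos, by simp [hw0]⟩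
  obtain ⟨e, c, k, he, hc, hk⟩ := hx.exists_norm_pow_eq hN hF hw0 h
  have hk0 : 0 < k := by
    by_contra! hk0
    obtain ⟨M, hM⟩ := exists_lt_norm_pow hc
    have hp : (p : ℚ_[p]) ≠ 0 := NeZero.ne _
    have h1 := pow_lt_pow_left₀ (hw _ (pow_ne_zero M hp)) (N.nonneg _) he.ne'
    have h2 : N (ι ((p : ℚ_[p]) ^ M)) ^ e ≤ N (ι c) := by
      rw [← map_pow, ← map_pow ι, hx.norm_le_iff, norm_pow, norm_pow]
      exact (pow_le_of_le_one (by positivity)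
        (pow_le_one₀ (norm_nonneg _) Padic.norm_p_lt_one.le) he.ne').trans hM
    have h3 : N (ι c) ≤ N (ι c) * N x ^ k :=
      le_mul_of_one_le_right (N.nonneg _) (one_le_zpow_of_nonpos₀ hx.pos hx.lt_one.le hk0)
    exact (h1.trans_le (h2.trans h3)).ne hk
  refine ⟨e, k.toNat, c, he, by omega, ?_⟩
  rw [hk, ← zpow_natCast, Int.toNat_of_nonneg hk0.le]

end PadicLike.IsGeneric

/-- The dichotomy for definable functions near zero on the set of highly divisible elements. -/
theorem eventually_eq_zero_or_exists_norm_eq (hf : ∀ x y, f x = y ↔ graphTuple id x y ∈ S)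
    (hS : ∀ x y : ℚ_[p] ⊕ Fin 2 → ℚ_[p], (∀ g ∈ Λ, IsNthPow g.2 (intEval x g.1) ↔
      IsNthPow g.2 (intEval y g.1)) → (x ∈ S ↔ y ∈ S)) (hΛ : ∀ g ∈ Λ, 0 < g.2) :
    (∀ᶠ x in powFilter p, f x = 0) ∨ ∃ (m : ℕ) (j : ℤ) (h : ℚ_[p] → ℚ_[p]) (C c : ℚ_[p])
      (e l : ℕ), 0 < m ∧ (∀ z, z ≠ 0 → h (z ^ m) = z ^ j) ∧ C ≠ 0 ∧ 0 < e ∧ 0 < l ∧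
        ∀ᶠ x in powFilter p, ‖f x / (C * h x) - 1‖ ^ e = ‖c‖ * ‖x‖ ^ l := by
  let U := Ultrafilter.of (powFilter p)
  have hU : ↑U ≤ powFilter p := Ultrafilter.of_le _
  by_cases hy : (Germ.ofFun f : Germ (U : Filter ℚ_[p]) ℚ_[p]) = 0
  · exact .inl (eventually_eq_zero_of_ultrafilter hf hS hΛ hU (Germ.coe_eq.1 hy))
  right
  have hN := padicLike_germNorm (p := p) U
  have hx := isGeneric_germ hU
  obtain ⟨A, hA, hxA, hcA, halg⟩ :=
    PadicLike.exists_algebraic_subfield (germConst U) (Germ.ofFun id)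
  have hyA := germ_mem_of_rootClosed hf hS hΛ U hA hxA hcA
  obtain ⟨F, hF, hFy⟩ := halg _ hyA
  obtain ⟨e, c, k, he, hc, hk⟩ := hx.exists_norm_pow_eq hN hF hy hFy
  obtain ⟨ω, hω0, hω⟩ := Padic.exists_pow_eq_one p
  have hm : 0 < e * ω := mul_pos he hω0
  obtain ⟨h, hh⟩ := Padic.exists_powMap hω hm k
  obtain ⟨ξ, hξ⟩ := hx.isNthPow _ hm
  have hη := germ_powMap hU hm hh hξ
  have hξ0 : ξ ≠ 0 := by
    rintro rfl
    exact hx.ne_zero (by rw [← hξ, zero_pow hm.ne'])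
  have hξA : ξ ∈ A := by
    refine hA _ (X ^ (e * ω) - C (Germ.ofFun id)) (X_pow_sub_C_ne_zero hm _)
      (natDegree_X_pow_sub_C (n := e * ω)).le (fun i => ?_) ξ (by simp [hξ])
    rw [coeff_sub, coeff_X_pow, coeff_C]
    refine sub_mem (by split_ifs <;> simp) ?_
    split_ifs
    exacts [hxA, zero_mem _]
  have hηA : Germ.ofFun h ∈ A := hη ▸ zpow_mem hξA _
  have hηn : germNorm (p := p) U (Germ.ofFun h) ^ (e * ω) =
      (germNorm (p := p) U (Germ.ofFun id) ^ k) ^ ω := by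
    rw [hη, ← hξ, map_zpow₀, map_pow, ← zpow_natCast, ← zpow_natCast, ← zpow_natCast, ← zpow_mul,
      ← zpow_mul, ← zpow_mul]
    congr 1
    push_cast
    ring
  have hun : ∀ᶠ t in U, ‖f t / h t‖ ^ (e * ω) = ‖c ^ ω‖ := by
    have h1 : germNorm (p := p) U (Germ.ofFun f / Germ.ofFun h) ^ (e * ω) =
        germNorm (p := p) U (germConst U (c ^ ω)) := by
      rw [map_div₀, div_pow, hηn, pow_mul, hk, mul_pow, map_pow, map_pow,
        mul_div_cancel_right₀ _ (pow_ne_zero _ (zpow_ne_zero _ hx.pos.ne'))]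
    exact Germ.coe_eq.1 h1
  obtain ⟨C, hC, hlim⟩ := exists_tendsto_of_norm_pow_eq U hm (pow_ne_zero ω hc) hun
  have hwA : Germ.ofFun f / (germConst U C * Germ.ofFun h) - 1 ∈ A :=
    sub_mem (div_mem hyA (mul_mem (hcA C) hηA)) (one_mem A)
  obtain ⟨G, hG, hGw⟩ := halg _ hwA
  obtain ⟨e', l, c', he', hl, hw⟩ := hx.exists_norm_pow_eq_of_infinitesimal hN hG hGw (by
    intro d hd
    have h1 : Tendsto (fun t => ‖f t / (C * h t) - 1‖) U (𝓝 0) := by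
      have := ((hlim.div_const C).sub_const 1).norm
      rw [div_self hC, sub_self, norm_zero] at this
      refine this.congr fun t => ?_
      rw [div_div, mul_comm]
    exact Germ.coe_lt.2 (h1.eventually_lt_const (norm_pos_iff.2 hd)))
  exact ⟨_, _, h, C, c', e', l, hm, hh, hC, he', hl,
    eventually_norm_eq_of_ultrafilter hf hS hΛ hU hm hh C c' e' l (Germ.coe_eq.1 hw)⟩

end Asymptotics

theorem tendsto_norm_of_norm_pow_eq {p : ℕ} [Fact p.Prime] {s : Set ℚ_[p]} {g : ℚ_[p] → ℚ_[p]}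
    {c : ℚ_[p]} {e l : ℕ} (he : 0 < e) (hl : 0 < l)
    (h : ∀ x ∈ s, ‖g x - 1‖ ^ e = ‖c‖ * ‖x‖ ^ l) : Tendsto g (𝓝[s] 0) (𝓝 1) := by
  rw [tendsto_iff_norm_sub_tendsto_zero]
  have h1 : Tendsto (fun x : ℚ_[p] => (‖c‖ * ‖x‖ ^ l) ^ ((e : ℝ)⁻¹)) (𝓝[s] 0) (𝓝 0) := by
    have hcont : Continuous fun x : ℚ_[p] => (‖c‖ * ‖x‖ ^ l) ^ ((e : ℝ)⁻¹) := by
      refine Continuous.rpow_const (by fun_prop) fun x => .inr (by positivity)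
    have h2 := hcont.tendsto 0
    rw [norm_zero, zero_pow hl.ne', mul_zero, Real.zero_rpow (by positivity)] at h2
    exact h2.mono_left nhdsWithin_le_nhds
  refine h1.congr' ?_
  filter_upwards [self_mem_nhdsWithin] with x hx
  rw [← h x hx, Real.pow_rpow_inv_natCast (norm_nonneg _) he.ne']

end

/-- **Asymptotic behavior of a definable function near `0`.**
Let `f : ℚ_p → ℚ_p` be definable, and `D = {x ≠ 0 : v(x) ≥ ε, x ∈ P_n}`.  Then there are
`δ ≥ ε` and a positive multiple `m` of `n` such that, on
`S = {x ≠ 0 : v(x) ≥ δ, x ∈ P_m}`, either `f` vanishes identically, or there are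
`C ∈ ℚ_pˣ`, integers `a` and `b ≥ 1`, and an `(a/b)`-th power map `h` on `P_m` (a map
multiplicative on `P_m`, with nonzero values satisfying `(h x)^b = x^a` there) with
`f x / (C · h x) → 1` as `x → 0` within `S`. -/
theorem stmt16 (p : ℕ) [Fact p.Prime] (n : ℕ) (hn : 1 ≤ n) (ε : ℤ)
    (f : ℚ_[p] → ℚ_[p])
    (hfdef : Set.Definable (Set.univ : Set ℚ_[p]) FirstOrder.Language.ring
      {v : Fin 2 → ℚ_[p] | f (v 0) = v 1}) :
    ∃ δ : ℤ, ε ≤ δ ∧ ∃ m : ℕ, 0 < m ∧ n ∣ m ∧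
      ((∀ x : ℚ_[p], x ≠ 0 → δ ≤ x.valuation → (∃ y : ℚ_[p], y ^ m = x) → f x = 0) ∨
        (∃ C : ℚ_[p]ˣ, ∃ a b : ℤ, 1 ≤ b ∧ ∃ h : ℚ_[p] → ℚ_[p],
          (∀ x y : ℚ_[p], x ≠ 0 → y ≠ 0 → (∃ z : ℚ_[p], z ^ m = x) →
            (∃ z : ℚ_[p], z ^ m = y) → h (x * y) = h x * h y) ∧
          (∀ x : ℚ_[p], x ≠ 0 → (∃ z : ℚ_[p], z ^ m = x) → h x ≠ 0 ∧ (h x) ^ b = x ^ a) ∧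
          Filter.Tendsto (fun x => f x / ((C : ℚ_[p]) * h x))
            (𝓝[{x : ℚ_[p] | x ≠ 0 ∧ δ ≤ x.valuation ∧ ∃ y : ℚ_[p], y ^ m = x}] 0)
            (𝓝 1))) := by
  obtain ⟨S, ⟨Λ, hΛ, hS⟩, hf⟩ := isPowSet_of_definable hfdef
  have hf' : ∀ x y, f x = y ↔ graphTuple id x y ∈ S := fun x y => hf ![x, y]
  have hpow : ∀ (k m : ℕ) (x : ℚ_[p]), (∃ y, y ^ (k * m) = x) → ∃ y, y ^ m = x := by
    rintro k m _ ⟨y, rfl⟩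
    exact ⟨y ^ k, (pow_mul y k m).symm⟩
  rcases eventually_eq_zero_or_exists_norm_eq hf' hS hΛ with h0 |
    ⟨m, j, h, C, c, e, l, hm, hh, hC, he, hl, hev⟩
  · obtain ⟨δ, m, hm, h0⟩ := mem_powFilter.1 h0
    exact ⟨max ε δ, le_max_left _ _, n * m, by positivity, dvd_mul_right _ _, .inl
      fun x hx hv hp => h0 x hx ((le_max_right _ _).trans hv) (hpow n m x hp)⟩
  · obtain ⟨δ, k, hk, hev⟩ := mem_powFilter.1 hev
    have hroot : ∀ x : ℚ_[p], x ≠ 0 → (∃ y, y ^ (n * k * m) = x) → ∃ z, z ≠ 0 ∧ z ^ m = x := by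
      intro x hx hp
      obtain ⟨z, rfl⟩ := hpow (n * k) m x hp
      exact ⟨z, fun hz => hx (by rw [hz, zero_pow hm.ne']), rfl⟩
    refine ⟨max ε δ, le_max_left _ _, n * k * m, by positivity, ⟨k * m, by ring⟩, .inr
      ⟨Units.mk0 C hC, j, m, by exact_mod_cast hm, h, ?_, ?_, ?_⟩⟩
    · intro x y hx hy hpx hpy
      obtain ⟨z, hz, rfl⟩ := hroot x hx hpx
      obtain ⟨w, hw, rfl⟩ := hroot y hy hpy
      rw [← mul_pow, hh _ hz, hh _ hw, hh _ (mul_ne_zero hz hw), mul_zpow]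
    · intro x hx hpx
      obtain ⟨z, hz, rfl⟩ := hroot x hx hpx
      rw [hh _ hz]
      refine ⟨zpow_ne_zero _ hz, ?_⟩
      rw [← zpow_mul, mul_comm, zpow_mul, zpow_natCast]
    · refine tendsto_norm_of_norm_pow_eq (c := c) he hl fun x hx => ?_
      refine hev x hx.1 ((le_max_right _ _).trans hx.2.1) (hpow (n * m) k x ?_)
      rw [show n * m * k = n * k * m by ring]
      exact hx.2.2
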